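/- The minimal triangulation of the polytope R_m has exactly m-1 tetrahedra and the maximal triangulation has exactly 2m-3 tetrahedra, where the maximal path used has m-1 edges. -/

import Mathlib

open Set MeasureTheory
open scoped Classical

noncomputable section

abbrev Pt3 := Fin 3 → ℝ

/-- A (geometric) tetrahedron: 4 affinely independent points. -/
def IsTet (σ : Finset Pt3) : Prop :=
  σ.card = 4 ∧ AffineIndependent ℝ (fun p : (σ : Set Pt3) => (p : Pt3))

/-- A dissection of the convex polytope `conv V` using only vertices in `V`:
tetrahedra with pairwise disjoint interiors covering the polytope. -/
def IsDissection (V : Finset Pt3) (D : Finset (Finset Pt3)) : Prop :=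
  (∀ σ ∈ D, IsTet σ ∧ (σ : Set Pt3) ⊆ (V : Set Pt3)) ∧
  (∀ σ ∈ D, ∀ τ ∈ D, σ ≠ τ →
    interior (convexHull ℝ (σ : Set Pt3)) ∩ interior (convexHull ℝ (τ : Set Pt3)) = ∅) ∧
  (⋃ σ ∈ D, convexHull ℝ (σ : Set Pt3)) = convexHull ℝ (V : Set Pt3)

/-- A triangulation: a dissection in which any two tetrahedra meet in a common
(possibly empty) face. -/
def IsTriangulation (V : Finset Pt3) (D : Finset (Finset Pt3)) : Prop :=
  IsDissection V D ∧
  ∀ σ ∈ D, ∀ τ ∈ D,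
    convexHull ℝ (σ : Set Pt3) ∩ convexHull ℝ (τ : Set Pt3)
      = convexHull ℝ ((σ ∩ τ : Finset Pt3) : Set Pt3)


/-- planar cross product -/
def cr (u v : Pt3) : ℝ := u 0 * v 1 - u 1 * v 0

/-- a linear functional given by coefficients -/
def lf (a b d : ℝ) : Pt3 →ₗ[ℝ] ℝ :=
  a • LinearMap.proj 0 + b • LinearMap.proj 1 + d • LinearMap.proj 2

lemma lf_apply (a b d : ℝ) (x : Pt3) : lf a b d x = a * x 0 + b * x 1 + d * x 2 := by
  simp [lf]

lemma sep_lemma (G : Pt3 →ₗ[ℝ] ℝ) (k : ℝ) (σ τ : Finset Pt3)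
    (h1 : ∀ p ∈ σ, k ≤ G p) (h2 : ∀ p ∈ τ, G p ≤ k) (h3 : ∀ p ∈ σ, G p = k → p ∈ τ) :
    convexHull ℝ (σ : Set Pt3) ∩ convexHull ℝ (τ : Set Pt3)
      ⊆ convexHull ℝ ((σ ∩ τ : Finset Pt3) : Set Pt3) := by
  rintro x ⟨hx1, hx2⟩
  have hGx : G x ≤ k := by
    have : convexHull ℝ (τ : Set Pt3) ⊆ {y | G y ≤ k} :=
      convexHull_min (fun p hp => h2 p hp) (convex_halfSpace_le G.isLinear k)
    exact this hx2
  rw [Finset.mem_convexHull'] at hx1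
  obtain ⟨w, hw0, hw1, hwx⟩ := hx1
  have hs : ∑ p ∈ σ, w p * (G p - k) = G x - k := by
    rw [← hwx, map_sum]
    simp only [map_smul, smul_eq_mul, mul_sub, Finset.sum_sub_distrib, ← Finset.sum_mul, hw1, one_mul]
  have hnn : ∀ p ∈ σ, 0 ≤ w p * (G p - k) := fun p hp =>
    mul_nonneg (hw0 p hp) (sub_nonneg.2 (h1 p hp))
  have hz : ∑ p ∈ σ, w p * (G p - k) = 0 :=
    le_antisymm (by rw [hs]; linarith) (Finset.sum_nonneg hnn)
  rw [Finset.sum_eq_zero_iff_of_nonneg hnn] at hz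
  have hzero : ∀ p ∈ σ, p ∉ σ ∩ τ → w p = 0 := by
    intro p hp hpn
    by_contra hne
    have := hz p hp
    have h4 : G p = k := by
      rcases mul_eq_zero.1 this with h | h
      · exact absurd h hne
      · linarith
    exact hpn (Finset.mem_inter.2 ⟨hp, h3 p hp h4⟩)
  rw [Finset.mem_convexHull']
  refine ⟨w, fun p hp => hw0 p (Finset.mem_inter.1 hp).1, ?_, ?_⟩
  · rw [← hw1]
    exact Finset.sum_subset Finset.inter_subset_left hzero
  · rw [← hwx]
    exact Finset.sum_subset Finset.inter_subset_left (fun p hp hpn => by simp [hzero p hp hpn])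

lemma interior_small (ρ : Finset Pt3) (h : ρ.card < 4) :
    interior (convexHull ℝ (ρ : Set Pt3)) = ∅ := by
  by_contra hne
  have hne' := Set.nonempty_iff_ne_empty.2 hne
  rw [interior_convexHull_nonempty_iff_affineSpan_eq_top] at hne'
  have h1 : vectorSpan ℝ (ρ : Set Pt3) = ⊤ := by
    rw [← direction_affineSpan, hne', AffineSubspace.direction_top]
  have hcard : ρ.card ≠ 0 := by
    intro h0
    rw [Finset.card_eq_zero] at h0
    subst h0
    simp at hne'
  obtain ⟨n, hn⟩ : ∃ n, ρ.card = n + 1 := ⟨ρ.card - 1, by omega⟩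
  have h2 := finrank_vectorSpan_image_finset_le ℝ (id : Pt3 → Pt3) ρ hn
  rw [Finset.coe_image, Set.image_id] at h2
  rw [h1] at h2
  simp at h2
  omega

/-- convenient form of being a triangulation -/
def Pre (V : Finset Pt3) (T : Finset (Finset Pt3)) : Prop :=
  (∀ σ ∈ T, IsTet σ ∧ σ ⊆ V) ∧
  (∀ σ ∈ T, ∀ τ ∈ T, convexHull ℝ (σ : Set Pt3) ∩ convexHull ℝ (τ : Set Pt3)
      ⊆ convexHull ℝ ((σ ∩ τ : Finset Pt3) : Set Pt3)) ∧
  (∀ x ∈ convexHull ℝ (V : Set Pt3), ∃ σ ∈ T, x ∈ convexHull ℝ (σ : Set Pt3))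

lemma Pre.tri {V : Finset Pt3} {T : Finset (Finset Pt3)} (h : Pre V T) : IsTriangulation V T := by
  obtain ⟨h1, h2, h3⟩ := h
  have h4 : ∀ σ ∈ T, ∀ τ ∈ T, convexHull ℝ (σ : Set Pt3) ∩ convexHull ℝ (τ : Set Pt3)
      = convexHull ℝ ((σ ∩ τ : Finset Pt3) : Set Pt3) := by
    intro σ hσ τ hτ
    refine Set.Subset.antisymm (h2 σ hσ τ hτ) (Set.subset_inter ?_ ?_)
    · exact convexHull_mono (by exact_mod_cast Finset.inter_subset_left)
    · exact convexHull_mono (by exact_mod_cast Finset.inter_subset_right)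
  refine ⟨⟨fun σ hσ => ⟨(h1 σ hσ).1, by exact_mod_cast (h1 σ hσ).2⟩, ?_, ?_⟩, h4⟩
  · intro σ hσ τ hτ hne
    rw [← interior_inter, h4 σ hσ τ hτ]
    apply interior_small
    have c1 := (h1 σ hσ).1.1
    have c2 := (h1 τ hτ).1.1
    by_contra hc
    have e1 : σ ∩ τ = σ := Finset.eq_of_subset_of_card_le Finset.inter_subset_left (by omega)
    have e2 : σ ∩ τ = τ := Finset.eq_of_subset_of_card_le Finset.inter_subset_right (by omega)
    exact hne (e1.symm.trans e2)
  · ext x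
    simp only [Set.mem_iUnion]
    constructor
    · rintro ⟨σ, hσ, hx⟩
      exact convexHull_mono (by exact_mod_cast (h1 σ hσ).2) hx
    · intro hx
      obtain ⟨σ, hσ, hx⟩ := h3 x hx
      exact ⟨σ, hσ, hx⟩

lemma isTet_of (a b c d : Pt3)
    (h : ∀ w1 w2 w3 w4 : ℝ, w1 + w2 + w3 + w4 = 0 →
      (∀ i, w1 * a i + w2 * b i + w3 * c i + w4 * d i = 0) →
      w1 = 0 ∧ w2 = 0 ∧ w3 = 0 ∧ w4 = 0) : IsTet {a, b, c, d} := by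
  have hab : a ≠ b := by
    rintro rfl
    have := h 1 (-1) 0 0 (by norm_num) (fun i => by ring)
    norm_num at this
  have hac : a ≠ c := by
    rintro rfl
    have := h 1 0 (-1) 0 (by norm_num) (fun i => by ring)
    norm_num at this
  have had : a ≠ d := by
    rintro rfl
    have := h 1 0 0 (-1) (by norm_num) (fun i => by ring)
    norm_num at this
  have hbc : b ≠ c := by
    rintro rfl
    have := h 0 1 (-1) 0 (by norm_num) (fun i => by ring)
    norm_num at this
  have hbd : b ≠ d := by
    rintro rfl
    have := h 0 1 0 (-1) (by norm_num) (fun i => by ring)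
    norm_num at this
  have hcd : c ≠ d := by
    rintro rfl
    have := h 0 0 1 (-1) (by norm_num) (fun i => by ring)
    norm_num at this
  refine ⟨?_, ?_⟩
  · rw [Finset.card_insert_of_notMem, Finset.card_insert_of_notMem, Finset.card_insert_of_notMem,
      Finset.card_singleton] <;> simp [*]
  · have hai : AffineIndependent ℝ ![a, b, c, d] := by
      rw [affineIndependent_iff_of_fintype]
      intro w hw hv
      rw [Finset.weightedVSub_eq_linear_combination _ hw] at hv
      rw [Fin.sum_univ_four] at hw hv
      have := h (w 0) (w 1) (w 2) (w 3) hw (fun i => by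
        have := congrFun hv i
        simpa using this)
      intro i
      fin_cases i <;> simp [this]
    have := hai.range
    have e : Set.range ![a, b, c, d] = (({a, b, c, d} : Finset Pt3) : Set Pt3) := by
      ext x
      simp only [Set.mem_range, Fin.exists_fin_succ, Finset.coe_insert, Finset.coe_singleton,
        Set.mem_insert_iff, Set.mem_singleton_iff]
      simp [eq_comm]
    rw [e] at this
    exact this

lemma comb_mem (V : Set Pt3) (a b c d x : Pt3) (ha : a ∈ V) (hb : b ∈ V) (hc : c ∈ V) (hd : d ∈ V)
    (w1 w2 w3 w4 : ℝ) (h1 : 0 ≤ w1) (h2 : 0 ≤ w2) (h3 : 0 ≤ w3) (h4 : 0 ≤ w4)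
    (hs : w1 + w2 + w3 + w4 = 1)
    (hx : ∀ i, x i = w1 * a i + w2 * b i + w3 * c i + w4 * d i) :
    x ∈ convexHull ℝ V := by
  have := (convex_convexHull ℝ V).sum_mem (t := Finset.univ) (w := ![w1, w2, w3, w4])
    (z := ![a, b, c, d]) (by intro i _; fin_cases i <;> simpa)
    (by rw [Fin.sum_univ_four]; simpa using hs)
    (by intro i _; fin_cases i <;> simp <;> exact subset_convexHull ℝ _ (by assumption))
  rw [Fin.sum_univ_four] at this
  convert this using 1
  ext i
  rw [hx i]; simp

/-- convex position -/
def CP (S : Finset Pt3) : Prop :=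
  ∀ q ∈ S, q ∉ convexHull ℝ ((S.erase q : Finset Pt3) : Set Pt3)

lemma CP.mono {S R : Finset Pt3} (h : CP S) (hR : R ⊆ S) : CP R := by
  intro q hq hc
  exact h q (hR hq) (convexHull_mono (by exact_mod_cast Finset.erase_subset_erase q hR) hc)

lemma CP.comb {S : Finset Pt3} (h : CP S) {q a b c : Pt3} (hq : q ∈ S) (ha : a ∈ S) (hb : b ∈ S)
    (hc : c ∈ S) (qa : q ≠ a) (qb : q ≠ b) (qc : q ≠ c) (w1 w2 w3 : ℝ) (h1 : 0 ≤ w1) (h2 : 0 ≤ w2)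
    (h3 : 0 ≤ w3) (hs : w1 + w2 + w3 = 1) (hx : ∀ i, q i = w1 * a i + w2 * b i + w3 * c i) : False := by
  refine h q hq (comb_mem _ a b c c q ?_ ?_ ?_ ?_ w1 w2 w3 0 h1 h2 h3 le_rfl (by linarith)
    (fun i => by rw [hx i]; ring)) <;> simp <;> tauto

lemma cone_lemma (S : Finset Pt3) (c : Pt3) (hcS : c ∉ S) (hpl : ∀ q ∈ insert c S, q 2 = 0)
    (hcp : CP (insert c S)) (hcard : 2 ≤ S.card) :
    ∃ r ∈ S, ∃ s ∈ S, r ≠ s ∧ ∀ q ∈ S, q ≠ r → q ≠ s → ∃ α β : ℝ, 0 ≤ α ∧ 0 ≤ β ∧ 1 < α + β ∧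
      ∀ i, q i - c i = α * (r i - c i) + β * (s i - c i) := by
  have hc : c ∉ convexHull ℝ (S : Set Pt3) := by
    have := hcp c (Finset.mem_insert_self _ _)
    rwa [Finset.erase_insert hcS] at this
  have hcpt : IsCompact (convexHull ℝ (S : Set Pt3)) := S.finite_toSet.isCompact_convexHull ℝ
  obtain ⟨φ, u, hφ1, hφ2⟩ := geometric_hahn_banach_point_closed (convex_convexHull ℝ (S : Set Pt3))
    hcpt.isClosed hc
  obtain ⟨a, b, hab⟩ : ∃ a b : ℝ, ∀ q ∈ S, φ q - φ c = a * (q 0 - c 0) + b * (q 1 - c 1) := by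
    refine ⟨φ (Pi.single 0 1), φ (Pi.single 1 1), fun q hq => ?_⟩
    have hv : q - c = (q 0 - c 0) • (Pi.single 0 1 : Pt3) + (q 1 - c 1) • (Pi.single 1 1 : Pt3) := by
      have h1 := hpl q (by simp [hq])
      have h2 := hpl c (by simp)
      ext i
      fin_cases i <;> simp [h1, h2]
    rw [← map_sub, hv, map_add, map_smul, map_smul]
    simp only [smul_eq_mul]; ring
  have hpos : ∀ q ∈ S, 0 < a * (q 0 - c 0) + b * (q 1 - c 1) := by
    intro q hq
    rw [← hab q hq]
    have := hφ2 q (subset_convexHull ℝ _ hq)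
    linarith
  set F : Pt3 → ℝ := fun q => a * (q 0 - c 0) + b * (q 1 - c 1) with hF
  set P : Pt3 → ℝ := fun q => a * (q 1 - c 1) - b * (q 0 - c 0) with hP
  have hne : S.Nonempty := Finset.card_pos.1 (by omega)
  obtain ⟨r, hr, hrm⟩ := S.exists_min_image (fun q => P q / F q) hne
  obtain ⟨s, hs, hsm⟩ := S.exists_max_image (fun q => P q / F q) hne
  have hab0 : a ^ 2 + b ^ 2 ≠ 0 := by
    intro h0
    have ha : a = 0 := by nlinarith
    have hb : b = 0 := by nlinarith
    have := hpos r hr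
    simp [ha, hb] at this
  have key : ∀ q ∈ S, ∀ α β : ℝ, F q = α * F r + β * F s → P q = α * P r + β * P s →
      ∀ i, q i - c i = α * (r i - c i) + β * (s i - c i) := by
    intro q hq α β h1 h2
    simp only [hF, hP] at h1 h2
    have e2 := hpl q (by simp [hq])
    have e3 := hpl r (by simp [hr])
    have e4 := hpl s (by simp [hs])
    have e5 := hpl c (by simp)
    have g0 : q 0 - c 0 = α * (r 0 - c 0) + β * (s 0 - c 0) := by
      apply mul_left_cancel₀ hab0
      linear_combination a * h1 - b * h2
    have g1 : q 1 - c 1 = α * (r 1 - c 1) + β * (s 1 - c 1) := by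
      apply mul_left_cancel₀ hab0
      linear_combination b * h1 + a * h2
    intro i
    fin_cases i
    · exact g0
    · exact g1
    · simp [e2, e3, e4, e5]
  have hFr := hpos r hr
  have hFs := hpos s hs
  -- r and s have different slopes
  have hlt : P r / F r < P s / F s := by
    rcases (hrm s hs).lt_or_eq with h | h
    · exact h
    exfalso
    obtain ⟨q1, hq1, q2, hq2, h12⟩ := Finset.one_lt_card.1 (show 1 < S.card by omega)
    have main : ∀ q1 ∈ S, ∀ q2 ∈ S, q1 ≠ q2 → F q1 ≤ F q2 → False := by
      intro q1 hq1 q2 hq2 h12 hle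
      have hF1 := hpos q1 hq1
      have hF2 := hpos q2 hq2
      have m1 : P q1 / F q1 = P q2 / F q2 := by
        have a1 := hrm q1 hq1
        have a2 := hsm q1 hq1
        have a3 := hrm q2 hq2
        have a4 := hsm q2 hq2
        linarith
      have hPP : P q1 * F q2 = P q2 * F q1 := by
        rw [div_eq_div_iff hF1.ne' hF2.ne'] at m1
        exact m1
      have g0 : (q1 0 - c 0) * F q2 = F q1 * (q2 0 - c 0) := by
        apply mul_left_cancel₀ hab0
        have : F q1 * F q2 = F q2 * F q1 := mul_comm _ _
        simp only [hF, hP] at hPP this ⊢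
        linear_combination -b * hPP
      have g1 : (q1 1 - c 1) * F q2 = F q1 * (q2 1 - c 1) := by
        apply mul_left_cancel₀ hab0
        simp only [hF, hP] at hPP ⊢
        linear_combination a * hPP
      have e1 := hpl q1 (by simp [hq1])
      have e2 := hpl q2 (by simp [hq2])
      have e5 := hpl c (by simp)
      refine hcp.comb (q := q1) (a := q2) (b := c) (c := c) (by simp [hq1]) (by simp [hq2])
        (by simp) (by simp) h12 (fun h => hcS (h ▸ hq1)) (fun h => hcS (h ▸ hq1))
        (F q1 / F q2) (1 - F q1 / F q2) 0 (div_nonneg hF1.le hF2.le) ?_ le_rfl (by ring) ?_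
      · rw [sub_nonneg, div_le_one hF2]; exact hle
      · intro i
        have hi : (q1 i - c i) * F q2 = F q1 * (q2 i - c i) := by
          fin_cases i
          · exact g0
          · exact g1
          · simp [e1, e2, e5]
        have : q1 i - c i = F q1 / F q2 * (q2 i - c i) := by
          rw [div_mul_eq_mul_div, eq_div_iff hF2.ne']; exact hi
        linear_combination this
    rcases le_total (F q1) (F q2) with hl | hl
    · exact main q1 hq1 q2 hq2 h12 hl
    · exact main q2 hq2 q1 hq1 h12.symm hl
  refine ⟨r, hr, s, hs, ?_, ?_⟩
  · rintro rfl
    exact lt_irrefl _ hlt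
  intro q hq hqr hqs
  have hFq := hpos q hq
  have m1 := hrm q hq
  have m2 := hsm q hq
  have hD : 0 < P s / F s - P r / F r := sub_pos.2 hlt
  set mr := P r / F r with hmr
  set ms := P s / F s with hms
  set mq := P q / F q with hmq
  have eP : P q = mq * F q := by rw [hmq, div_mul_cancel₀ _ hFq.ne']
  have ePr : P r = mr * F r := by rw [hmr, div_mul_cancel₀ _ hFr.ne']
  have ePs : P s = ms * F s := by rw [hms, div_mul_cancel₀ _ hFs.ne']
  have hα : 0 ≤ F q / F r * ((ms - mq) / (ms - mr)) :=
    mul_nonneg (div_nonneg hFq.le hFr.le) (div_nonneg (by linarith) hD.le)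
  have hβ : 0 ≤ F q / F s * ((mq - mr) / (ms - mr)) :=
    mul_nonneg (div_nonneg hFq.le hFs.le) (div_nonneg (by linarith) hD.le)
  have hk := key q hq (F q / F r * ((ms - mq) / (ms - mr))) (F q / F s * ((mq - mr) / (ms - mr)))
    (by
      have h1 := hFr.ne'
      have h2 := hFs.ne'
      have h3 := hD.ne'
      change F r ≠ 0 at h1
      change F s ≠ 0 at h2
      clear_value F P mr ms mq
      field_simp; ring)
    (by
      have h1 := hFr.ne'
      have h2 := hFs.ne'
      have h3 := hD.ne'
      change F r ≠ 0 at h1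
      change F s ≠ 0 at h2
      rw [eP, ePr, ePs]
      clear_value F P mr ms mq
      field_simp; ring)
  refine ⟨_, _, hα, hβ, ?_, hk⟩
  by_contra hle
  push Not at hle
  refine hcp.comb (q := q) (a := r) (b := s) (c := c) (by simp [hq]) (by simp [hr])
        (by simp [hs]) (by simp) hqr hqs (fun h => hcS (h ▸ hq)) _ _ _ hα hβ (sub_nonneg.2 hle)
        (by ring) ?_
  intro i
  linear_combination hk i

lemma cover2 (S : Finset Pt3) (c r s : Pt3) (hr : r ∈ S) (hs : s ∈ S)
    (hcone : ∀ q ∈ S, q ≠ r → q ≠ s → ∃ α β : ℝ, 0 ≤ α ∧ 0 ≤ β ∧ 1 < α + β ∧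
      ∀ i, q i - c i = α * (r i - c i) + β * (s i - c i))
    (x : Pt3) (hx : x ∈ convexHull ℝ ((insert c S : Finset Pt3) : Set Pt3)) :
    x ∈ convexHull ℝ (S : Set Pt3) ∨ ∃ w1 w2 w3 : ℝ, 0 ≤ w1 ∧ 0 ≤ w2 ∧ 0 ≤ w3 ∧ w1 + w2 + w3 = 1 ∧
      ∀ i, x i = w1 * r i + w2 * s i + w3 * c i := by
  have hsub : convexHull ℝ (S : Set Pt3) ⊆ {q | ∃ α β : ℝ, 0 ≤ α ∧ 0 ≤ β ∧ 1 ≤ α + β ∧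
      ∀ i, q i - c i = α * (r i - c i) + β * (s i - c i)} := by
    apply convexHull_min
    · intro q hq
      by_cases h1 : q = r
      · exact ⟨1, 0, by norm_num, by norm_num, by norm_num, fun i => by rw [h1]; ring⟩
      by_cases h2 : q = s
      · exact ⟨0, 1, by norm_num, by norm_num, by norm_num, fun i => by rw [h2]; ring⟩
      obtain ⟨α, β, ha, hb, hab, h⟩ := hcone q hq h1 h2
      exact ⟨α, β, ha, hb, hab.le, h⟩
    · rintro x ⟨α, β, ha, hb, hab, h⟩ y ⟨α', β', ha', hb', hab', h'⟩ u v hu hv huv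
      refine ⟨u * α + v * α', u * β + v * β', by positivity, by positivity, by nlinarith, fun i => ?_⟩
      simp only [Pi.add_apply, Pi.smul_apply, smul_eq_mul]
      linear_combination u * h i + v * h' i + c i * huv
  rw [Finset.coe_insert, convexHull_insert ⟨r, hr⟩, convexJoin_singleton_left] at hx
  simp only [Set.mem_iUnion] at hx
  obtain ⟨q, hq, hxq⟩ := hx
  obtain ⟨u, l, hu, hl, hul, rfl⟩ := hxq
  obtain ⟨α, β, ha, hb, hab, h⟩ := hsub hq
  by_cases hle : l * (α + β) ≤ 1
  · right
    refine ⟨l * α, l * β, 1 - l * (α + β), by positivity, by positivity, by linarith, by ring, fun i => ?_⟩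
    simp only [Pi.add_apply, Pi.smul_apply, smul_eq_mul]
    linear_combination l * h i + c i * hul
  · left
    push Not at hle
    have hD : 1 < α + β := by nlinarith
    have hD' : 0 < α + β - 1 := by linarith
    have hD0 : 0 < α + β := by linarith
    have hz : (α / (α + β)) • r + (β / (α + β)) • s ∈ convexHull ℝ (S : Set Pt3) := by
      apply convex_convexHull ℝ _ (subset_convexHull ℝ _ hr) (subset_convexHull ℝ _ hs)
        (by positivity) (by positivity)
      field_simp
    have hmu : 0 ≤ (l * (α + β) - 1) / (α + β - 1) := div_nonneg (by linarith) hD'.le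
    have hmu1 : 0 ≤ 1 - (l * (α + β) - 1) / (α + β - 1) := by
      rw [sub_nonneg, div_le_one hD']
      nlinarith
    have := convex_convexHull ℝ (S : Set Pt3) hz hq hmu1 hmu (by ring)
    convert this using 1
    ext i
    simp only [Pi.add_apply, Pi.smul_apply, smul_eq_mul]
    have hq' : q i = c i + α * (r i - c i) + β * (s i - c i) := by linarith [h i]
    have hu' : u = 1 - l := by linarith
    rw [hq', hu']
    field_simp
    ring

lemma visible_functional (S : Finset Pt3) (c r s v₁ v₂ : Pt3) (hr : r ∈ S) (hs : s ∈ S)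
    (hpl : ∀ q ∈ insert c S, q 2 = 0)
    (hcone : ∀ q ∈ S, q ≠ r → q ≠ s → ∃ α β : ℝ, 0 ≤ α ∧ 0 ≤ β ∧ 1 < α + β ∧
      ∀ i, q i - c i = α * (r i - c i) + β * (s i - c i))
    (hpar : v₁ 2 = v₂ 2) (hside : 0 < v₁ 2) (A B κ : ℝ) (hAB : A + B = 1) (hκ : 0 < κ)
    (hc : ∀ i, c i = A * r i + B * s i - κ * (v₂ i - v₁ i))
    (hD : cr (s - r) (v₂ - v₁) ≠ 0) :
    ∃ (G : Pt3 →ₗ[ℝ] ℝ) (k : ℝ), G r = k ∧ G s = k ∧ G v₁ = k ∧ k < G v₂ ∧ G c < k ∧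
      ∀ q ∈ S, q ≠ r → q ≠ s → k < G q := by
  have er := hpl r (by simp [hr])
  have es := hpl s (by simp [hs])
  have ec := hpl c (by simp)
  set D := cr (s - r) (v₂ - v₁) with hDdef
  set a := -(s 1 - r 1) / D with ha
  set b := (s 0 - r 0) / D with hb
  set k := a * r 0 + b * r 1 with hk
  set d := (k - a * v₁ 0 - b * v₁ 1) / v₁ 2 with hd
  have hD2 : D = (s 0 - r 0) * (v₂ 1 - v₁ 1) - (s 1 - r 1) * (v₂ 0 - v₁ 0) := by
    simp [hDdef, cr]
  have hN : a * (v₂ 0 - v₁ 0) + b * (v₂ 1 - v₁ 1) = 1 := by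
    rw [ha, hb]; field_simp; rw [hD2]; ring
  have hrs : a * s 0 + b * s 1 = k := by
    rw [hk, ha, hb]; field_simp; ring
  have hdv : d * v₁ 2 = k - a * v₁ 0 - b * v₁ 1 := by
    rw [hd]; field_simp
  have g1 : lf a b d r = k := by rw [lf_apply, er]; linarith
  have g2 : lf a b d s = k := by rw [lf_apply, es]; linarith
  have g3 : lf a b d v₁ = k := by rw [lf_apply]; linarith
  have g4 : lf a b d v₂ = k + 1 := by rw [lf_apply, ← hpar]; linarith
  have g5 : lf a b d c = k - κ := by
    have : c = A • r + B • s - κ • (v₂ - v₁) := by ext i; simp [hc i]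
    rw [this, map_sub, map_add, map_smul, map_smul, map_smul, map_sub, g1, g2, g3, g4]
    simp only [smul_eq_mul]
    linear_combination k * hAB
  refine ⟨lf a b d, k, g1, g2, g3, by linarith, by linarith, ?_⟩
  intro q hq hqr hqs
  obtain ⟨α, β, hα, hβ, hαβ, h⟩ := hcone q hq hqr hqs
  have : q = c + α • (r - c) + β • (s - c) := by
    ext i
    simp only [Pi.add_apply, Pi.smul_apply, smul_eq_mul, Pi.sub_apply]
    linarith [h i]
  rw [this, map_add, map_add, map_smul, map_smul, map_sub, map_sub, g1, g2, g5]
  simp only [smul_eq_mul]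
  nlinarith

lemma tet_rsc (c r s v₁ v₂ : Pt3) (er : r 2 = 0) (es : s 2 = 0) (ec : c 2 = 0)
    (hside : 0 < v₁ 2) (A B κ : ℝ) (hAB : A + B = 1) (hκ : 0 < κ)
    (hc : ∀ i, c i = A * r i + B * s i - κ * (v₂ i - v₁ i))
    (hD : cr (s - r) (v₂ - v₁) ≠ 0) : IsTet {v₁, r, s, c} := by
  apply isTet_of
  intro w1 w2 w3 w4 hw h
  have h2 := h 2
  rw [er, es, ec] at h2
  have hw1 : w1 = 0 := by
    have : w1 * v₁ 2 = 0 := by linarith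
    rcases mul_eq_zero.1 this with h | h
    · exact h
    · exact absurd h hside.ne'
  have h0 := h 0
  have h1 := h 1
  have c0 := hc 0
  have c1 := hc 1
  subst hw1
  have e0 : w3 * (s 0 - r 0) + w4 * (c 0 - r 0) = 0 := by linear_combination h0 - r 0 * hw
  have e1 : w3 * (s 1 - r 1) + w4 * (c 1 - r 1) = 0 := by linear_combination h1 - r 1 * hw
  have hA : A = 1 - B := by linarith
  subst hA
  have hw4 : w4 = 0 := by
    have : (w4 * κ) * cr (s - r) (v₂ - v₁) = 0 := by
      simp only [cr, Pi.sub_apply]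
      rw [c0] at e0
      rw [c1] at e1
      linear_combination (s 1 - r 1) * e0 - (s 0 - r 0) * e1
    rcases mul_eq_zero.1 this with h | h
    · rcases mul_eq_zero.1 h with h | h
      · exact h
      · exact absurd h hκ.ne'
    · exact absurd h hD
  subst hw4
  have hw3 : w3 = 0 := by
    by_contra hne
    apply hD
    have f0 : s 0 - r 0 = 0 := by
      have : w3 * (s 0 - r 0) = 0 := by linarith
      exact (mul_eq_zero.1 this).resolve_left hne
    have f1 : s 1 - r 1 = 0 := by
      have : w3 * (s 1 - r 1) = 0 := by linarith
      exact (mul_eq_zero.1 this).resolve_left hne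
    simp [cr, f0, f1]
  subst hw3
  refine ⟨rfl, by linarith, rfl, rfl⟩

lemma tet_vv (s c v₁ v₂ : Pt3) (es : s 2 = 0) (ec : c 2 = 0) (hpar : v₁ 2 = v₂ 2)
    (hside : 0 < v₁ 2) (hD : cr (v₂ - v₁) (c - s) ≠ 0) : IsTet {v₁, v₂, s, c} := by
  apply isTet_of
  intro w1 w2 w3 w4 hw h
  have h2 := h 2
  rw [es, ec, ← hpar] at h2
  have hw1 : w1 = -w2 := by
    have : (w1 + w2) * v₁ 2 = 0 := by linarith
    rcases mul_eq_zero.1 this with h | h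
    · linarith
    · exact absurd h hside.ne'
  have hw3 : w3 = -w4 := by linarith
  subst hw1 hw3
  have e0 : w2 * (v₂ 0 - v₁ 0) + w4 * (c 0 - s 0) = 0 := by linear_combination h 0
  have e1 : w2 * (v₂ 1 - v₁ 1) + w4 * (c 1 - s 1) = 0 := by linear_combination h 1
  have hw4 : w4 = 0 := by
    have : w4 * cr (v₂ - v₁) (c - s) = 0 := by
      simp only [cr, Pi.sub_apply]
      linear_combination (v₂ 0 - v₁ 0) * e1 - (v₂ 1 - v₁ 1) * e0
    exact (mul_eq_zero.1 this).resolve_right hD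
  have hw2 : w2 = 0 := by
    have : w2 * cr (v₂ - v₁) (c - s) = 0 := by
      simp only [cr, Pi.sub_apply]
      linear_combination -(c 0 - s 0) * e1 + (c 1 - s 1) * e0
    exact (mul_eq_zero.1 this).resolve_right hD
  subst hw4 hw2
  simp

lemma cover3 (S : Finset Pt3) (c r s v₁ v₂ : Pt3) (hr : r ∈ S) (hs : s ∈ S)
    (hcone : ∀ q ∈ S, q ≠ r → q ≠ s → ∃ α β : ℝ, 0 ≤ α ∧ 0 ≤ β ∧ 1 < α + β ∧
      ∀ i, q i - c i = α * (r i - c i) + β * (s i - c i))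
    (x : Pt3) (hx : x ∈ convexHull ℝ ((insert v₁ (insert v₂ (insert c S)) : Finset Pt3) : Set Pt3)) :
    x ∈ convexHull ℝ ((insert v₁ (insert v₂ S) : Finset Pt3) : Set Pt3) ∨
      ∃ w1 w2 w3 w4 w5 : ℝ, 0 ≤ w1 ∧ 0 ≤ w2 ∧ 0 ≤ w3 ∧ 0 ≤ w4 ∧ 0 ≤ w5 ∧
        w1 + w2 + w3 + w4 + w5 = 1 ∧
      ∀ i, x i = w1 * r i + w2 * s i + w3 * c i + w4 * v₁ i + w5 * v₂ i := by
  have e : ((insert v₁ (insert v₂ (insert c S)) : Finset Pt3) : Set Pt3)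
      = {v₁, v₂} ∪ ((insert c S : Finset Pt3) : Set Pt3) := by
    ext y; simp; tauto
  rw [e, convexHull_union (by simp) (by simp), mem_convexJoin] at hx
  obtain ⟨v, hv, q, hq, hxs⟩ := hx
  rcases cover2 S c r s hr hs hcone q hq with h | ⟨w1, w2, w3, h1, h2, h3, hsum, h⟩
  · left
    refine (convex_convexHull ℝ _).segment_subset ?_ ?_ hxs
    · exact convexHull_mono (by intro y; simp; tauto) hv
    · exact convexHull_mono (by intro y hy; simp at hy ⊢; tauto) h
  · right
    rw [convexHull_pair] at hv
    obtain ⟨a, b, ha, hb, hab, rfl⟩ := hv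
    obtain ⟨t, u, ht, hu, htu, rfl⟩ := hxs
    refine ⟨u * w1, u * w2, u * w3, t * a, t * b, by positivity, by positivity, by positivity,
      by positivity, by positivity, ?_, fun i => ?_⟩
    · linear_combination u * hsum + t * hab + htu
    · simp only [Pi.add_apply, Pi.smul_apply, smul_eq_mul, h i]
      ring

lemma stepA (S : Finset Pt3) (c r s v₁ v₂ : Pt3) (hr : r ∈ S) (hs : s ∈ S) (hcS : c ∉ S)
    (hpl : ∀ q ∈ insert c S, q 2 = 0)
    (hcone : ∀ q ∈ S, q ≠ r → q ≠ s → ∃ α β : ℝ, 0 ≤ α ∧ 0 ≤ β ∧ 1 < α + β ∧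
      ∀ i, q i - c i = α * (r i - c i) + β * (s i - c i))
    (hpar : v₁ 2 = v₂ 2) (hside : 0 < v₁ 2) (A B κ : ℝ) (hAB : A + B = 1) (hκ : 0 < κ)
    (hA : 0 ≤ A) (hB : 0 ≤ B)
    (hc : ∀ i, c i = A * r i + B * s i - κ * (v₂ i - v₁ i))
    (hD : cr (s - r) (v₂ - v₁) ≠ 0)
    (T : Finset (Finset Pt3)) (hT : Pre (insert v₁ (insert v₂ S)) T) :
    ∃ T', Pre (insert v₁ (insert v₂ (insert c S))) T' ∧ T'.card = T.card + 1 := by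
  have er := hpl r (by simp [hr])
  have es := hpl s (by simp [hs])
  have ec := hpl c (by simp)
  obtain ⟨G, k, gr, gs, gv1, gv2, gc, gq⟩ :=
    visible_functional S c r s v₁ v₂ hr hs hpl hcone hpar hside A B κ hAB hκ hc hD
  obtain ⟨t1, t2, t3⟩ := hT
  have hcV : c ∉ insert v₁ (insert v₂ S) := by
    simp only [Finset.mem_insert, not_or]
    refine ⟨?_, ?_, hcS⟩
    · rintro rfl; linarith
    · rintro rfl; linarith
  have hnew : ({v₁, r, s, c} : Finset Pt3) ∉ T := fun h => hcV ((t1 _ h).2 (by simp))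
  have hsep : ∀ σ ∈ T, convexHull ℝ (σ : Set Pt3) ∩
      convexHull ℝ (({v₁, r, s, c} : Finset Pt3) : Set Pt3)
      ⊆ convexHull ℝ ((σ ∩ {v₁, r, s, c} : Finset Pt3) : Set Pt3) := by
    intro σ hσ
    apply sep_lemma G k
    · intro p hp
      have := (t1 σ hσ).2 hp
      simp only [Finset.mem_insert] at this
      by_cases h1 : p = r
      · rw [h1, gr]
      by_cases h2 : p = s
      · rw [h2, gs]
      rcases this with h | h | h
      · rw [h, gv1]
      · rw [h]; exact gv2.le
      · exact (gq p h h1 h2).le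
    · intro p hp
      simp only [Finset.mem_insert, Finset.mem_singleton] at hp
      rcases hp with h | h | h | h <;> rw [h] <;> linarith
    · intro p hp hpk
      have := (t1 σ hσ).2 hp
      simp only [Finset.mem_insert, Finset.mem_singleton] at this ⊢
      by_cases h1 : p = r
      · tauto
      by_cases h2 : p = s
      · tauto
      rcases this with h | h | h
      · tauto
      · rw [h] at hpk; linarith
      · have := gq p h h1 h2; linarith
  refine ⟨insert {v₁, r, s, c} T, ⟨?_, ?_, ?_⟩, Finset.card_insert_of_notMem hnew⟩
  · intro σ hσ
    rcases Finset.mem_insert.1 hσ with rfl | hσ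
    · refine ⟨tet_rsc c r s v₁ v₂ er es ec hside A B κ hAB hκ hc hD, ?_⟩
      intro y hy
      simp only [Finset.mem_insert, Finset.mem_singleton] at hy ⊢
      rcases hy with h | h | h | h <;> subst h <;> tauto
    · refine ⟨(t1 σ hσ).1, (t1 σ hσ).2.trans ?_⟩
      intro y hy
      simp only [Finset.mem_insert] at hy ⊢
      tauto
  · intro σ hσ τ hτ
    rcases Finset.mem_insert.1 hσ with rfl | hσ <;> rcases Finset.mem_insert.1 hτ with rfl | hτ
    · simp
    · rw [Set.inter_comm, Finset.inter_comm]
      exact hsep τ hτ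
    · exact hsep σ hσ
    · exact t2 σ hσ τ hτ
  · intro x hx
    rcases cover3 S c r s v₁ v₂ hr hs hcone x hx with h |
      ⟨w1, w2, w3, w4, w5, h1, h2, h3, h4, h5, hsum, h⟩
    · obtain ⟨σ, hσ, hx⟩ := t3 x h
      exact ⟨σ, Finset.mem_insert_of_mem hσ, hx⟩
    by_cases hle : κ * w3 ≤ w5
    · obtain ⟨σ, hσ, hx⟩ := t3 x (comb_mem _ r s v₁ v₂ x (by simp [hr]) (by simp [hs]) (by simp) (by simp)
        (w1 + A * w3) (w2 + B * w3) (w4 + κ * w3) (w5 - κ * w3) (by positivity) (by positivity)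
        (by positivity) (by linarith) (by linear_combination hsum + w3 * hAB)
        (fun i => by rw [h i, hc i]; ring))
      exact ⟨σ, Finset.mem_insert_of_mem hσ, hx⟩
    · push Not at hle
      refine ⟨_, Finset.mem_insert_self _ _, comb_mem _ v₁ r s c x (by simp) (by simp) (by simp) (by simp)
        (w4 + w5) (w1 + A * (w5 / κ)) (w2 + B * (w5 / κ)) (w3 - w5 / κ) (by positivity) (by positivity)
        (by positivity) ?_ (by linear_combination hsum + (w5 / κ) * hAB) ?_⟩
      · rw [sub_nonneg, div_le_iff₀ hκ]; linarith
      · intro i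
        have e5 : w5 = κ * (w5 / κ) := by field_simp
        have e6 := hc i
        rw [h i]
        linear_combination (w5 / κ) * e6 - (v₁ i - v₂ i) * e5

set_option maxHeartbeats 1000000 in
lemma stepB (S : Finset Pt3) (c r s v₁ v₂ : Pt3) (hr : r ∈ S) (hs : s ∈ S) (hcS : c ∉ S)
    (hpl : ∀ q ∈ insert c S, q 2 = 0)
    (hcone : ∀ q ∈ S, q ≠ r → q ≠ s → ∃ α β : ℝ, 0 ≤ α ∧ 0 ≤ β ∧ 1 < α + β ∧
      ∀ i, q i - c i = α * (r i - c i) + β * (s i - c i))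
    (hpar : v₁ 2 = v₂ 2) (hside : 0 < v₁ 2) (A B κ : ℝ) (hAB : A + B = 1) (hκ : 0 < κ)
    (hA : A < 0)
    (hc : ∀ i, c i = A * r i + B * s i - κ * (v₂ i - v₁ i))
    (hD : cr (s - r) (v₂ - v₁) ≠ 0)
    (H : Pt3 →ₗ[ℝ] ℝ) (l : ℝ) (Hv1 : H v₁ = l) (Hv2 : H v₂ = l) (Hs : H s = l) (Hc : H c < l)
    (HS : ∀ q ∈ S, q ≠ s → l < H q) (hD2 : cr (v₂ - v₁) (c - s) ≠ 0)
    (T : Finset (Finset Pt3)) (hT : Pre (insert v₁ (insert v₂ S)) T) :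
    ∃ T', Pre (insert v₁ (insert v₂ (insert c S))) T' ∧ T'.card = T.card + 2 := by
  have er := hpl r (by simp [hr])
  have es := hpl s (by simp [hs])
  have ec := hpl c (by simp)
  obtain ⟨G, k, gr, gs, gv1, gv2, gc, gq⟩ :=
    visible_functional S c r s v₁ v₂ hr hs hpl hcone hpar hside A B κ hAB hκ hc hD
  have hrs : r ≠ s := by
    rintro rfl
    simp [cr] at hD
  obtain ⟨t1, t2, t3⟩ := hT
  have hcV : c ∉ insert v₁ (insert v₂ S) := by
    simp only [Finset.mem_insert, not_or]
    refine ⟨?_, ?_, hcS⟩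
    · rintro rfl; linarith
    · rintro rfl; linarith
  have hnew : ({v₁, r, s, c} : Finset Pt3) ∉ T := fun h => hcV ((t1 _ h).2 (by simp))
  have hnew2 : ({v₁, v₂, s, c} : Finset Pt3) ∉ T := fun h => hcV ((t1 _ h).2 (by simp))
  have hne12 : ({v₁, r, s, c} : Finset Pt3) ≠ {v₁, v₂, s, c} := by
    intro h
    have : r ∈ ({v₁, v₂, s, c} : Finset Pt3) := by rw [← h]; simp
    simp only [Finset.mem_insert, Finset.mem_singleton] at this
    rcases this with h | h | h | h
    · rw [h] at er; linarith
    · rw [h] at er; linarith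
    · exact hrs h
    · rw [h] at hr; exact hcS hr
  have hsep : ∀ σ ∈ T, convexHull ℝ (σ : Set Pt3) ∩
      convexHull ℝ (({v₁, r, s, c} : Finset Pt3) : Set Pt3)
      ⊆ convexHull ℝ ((σ ∩ {v₁, r, s, c} : Finset Pt3) : Set Pt3) := by
    intro σ hσ
    apply sep_lemma G k
    · intro p hp
      have := (t1 σ hσ).2 hp
      simp only [Finset.mem_insert] at this
      by_cases h1 : p = r
      · rw [h1, gr]
      by_cases h2 : p = s
      · rw [h2, gs]
      rcases this with h | h | h
      · rw [h, gv1]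
      · rw [h]; exact gv2.le
      · exact (gq p h h1 h2).le
    · intro p hp
      simp only [Finset.mem_insert, Finset.mem_singleton] at hp
      rcases hp with h | h | h | h <;> rw [h] <;> linarith
    · intro p hp hpk
      have := (t1 σ hσ).2 hp
      simp only [Finset.mem_insert, Finset.mem_singleton] at this ⊢
      by_cases h1 : p = r
      · tauto
      by_cases h2 : p = s
      · tauto
      rcases this with h | h | h
      · tauto
      · rw [h] at hpk; linarith
      · have := gq p h h1 h2; linarith
  have hsep2 : ∀ σ ∈ T, convexHull ℝ (σ : Set Pt3) ∩
      convexHull ℝ (({v₁, v₂, s, c} : Finset Pt3) : Set Pt3)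
      ⊆ convexHull ℝ ((σ ∩ {v₁, v₂, s, c} : Finset Pt3) : Set Pt3) := by
    intro σ hσ
    apply sep_lemma H l
    · intro p hp
      have := (t1 σ hσ).2 hp
      simp only [Finset.mem_insert] at this
      by_cases h2 : p = s
      · rw [h2, Hs]
      rcases this with h | h | h
      · rw [h, Hv1]
      · rw [h, Hv2]
      · exact (HS p h h2).le
    · intro p hp
      simp only [Finset.mem_insert, Finset.mem_singleton] at hp
      rcases hp with h | h | h | h <;> rw [h] <;> linarith
    · intro p hp hpk
      have := (t1 σ hσ).2 hp
      simp only [Finset.mem_insert, Finset.mem_singleton] at this ⊢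
      by_cases h2 : p = s
      · tauto
      rcases this with h | h | h
      · tauto
      · tauto
      · have := HS p h h2; linarith
  -- functional separating the two new tetrahedra
  have hsep3 : convexHull ℝ (({v₁, r, s, c} : Finset Pt3) : Set Pt3) ∩
      convexHull ℝ (({v₁, v₂, s, c} : Finset Pt3) : Set Pt3)
      ⊆ convexHull ℝ ((({v₁, r, s, c} : Finset Pt3) ∩ {v₁, v₂, s, c} : Finset Pt3) : Set Pt3) := by
    -- the functional `(k - G c) (H - l) - (l - H c) (G - k)` vanishes at `v₁, s, c`
    have hp : 0 < H r - l := by linarith [HS r hr hrs]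
    apply sep_lemma ((k - G c) • H - (l - H c) • G) ((k - G c) * l - (l - H c) * k)
    · intro p hp
      simp only [Finset.mem_insert, Finset.mem_singleton] at hp
      simp only [LinearMap.sub_apply, LinearMap.smul_apply, smul_eq_mul]
      rcases hp with h | h | h | h <;> subst h
      · rw [Hv1, gv1]
      · rw [gr]; nlinarith
      · rw [Hs, gs]
      · linarith
    · intro p hp
      simp only [Finset.mem_insert, Finset.mem_singleton] at hp
      simp only [LinearMap.sub_apply, LinearMap.smul_apply, smul_eq_mul]
      rcases hp with h | h | h | h <;> subst h
      · rw [Hv1, gv1]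
      · rw [Hv2]; nlinarith
      · rw [Hs, gs]
      · linarith
    · intro p hp hpk
      simp only [Finset.mem_insert, Finset.mem_singleton] at hp ⊢
      simp only [LinearMap.sub_apply, LinearMap.smul_apply, smul_eq_mul] at hpk
      rcases hp with h | h | h | h
      · tauto
      · rw [h, gr] at hpk; nlinarith
      · tauto
      · tauto
  refine ⟨insert {v₁, v₂, s, c} (insert {v₁, r, s, c} T), ⟨?_, ?_, ?_⟩, ?_⟩
  · intro σ hσ
    rcases Finset.mem_insert.1 hσ with rfl | hσ
    · refine ⟨tet_vv s c v₁ v₂ es ec hpar hside hD2, ?_⟩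
      intro y hy
      simp only [Finset.mem_insert, Finset.mem_singleton] at hy ⊢
      rcases hy with h | h | h | h <;> subst h <;> tauto
    rcases Finset.mem_insert.1 hσ with rfl | hσ
    · refine ⟨tet_rsc c r s v₁ v₂ er es ec hside A B κ hAB hκ hc hD, ?_⟩
      intro y hy
      simp only [Finset.mem_insert, Finset.mem_singleton] at hy ⊢
      rcases hy with h | h | h | h <;> subst h <;> tauto
    · refine ⟨(t1 σ hσ).1, (t1 σ hσ).2.trans ?_⟩
      intro y hy
      simp only [Finset.mem_insert] at hy ⊢
      tauto
  · intro σ hσ τ hτ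
    rcases Finset.mem_insert.1 hσ with rfl | hσ <;> rcases Finset.mem_insert.1 hτ with rfl | hτ
    · simp
    · rw [Set.inter_comm, Finset.inter_comm]
      rcases Finset.mem_insert.1 hτ with rfl | hτ
      · exact hsep3
      · exact hsep2 τ hτ
    · rcases Finset.mem_insert.1 hσ with rfl | hσ
      · exact hsep3
      · exact hsep2 σ hσ
    rcases Finset.mem_insert.1 hσ with rfl | hσ <;> rcases Finset.mem_insert.1 hτ with rfl | hτ
    · simp
    · rw [Set.inter_comm, Finset.inter_comm]
      exact hsep τ hτ
    · exact hsep σ hσ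
    · exact t2 σ hσ τ hτ
  · intro x hx
    rcases cover3 S c r s v₁ v₂ hr hs hcone x hx with h |
      ⟨w1, w2, w3, w4, w5, h1, h2, h3, h4, h5, hsum, h⟩
    · obtain ⟨σ, hσ, hx⟩ := t3 x h
      exact ⟨σ, by simp [hσ], hx⟩
    have hB : 0 < B := by linarith
    obtain ⟨a, rfl⟩ : ∃ a, A = -a := ⟨-A, by ring⟩
    have ha : 0 < a := by linarith
    -- the circuit: c + a r + κ v₂ = B s + κ v₁
    have red : ∀ μ : ℝ, 0 ≤ μ → ∀ i, x i = (w1 - a * μ) * r i + (w2 + B * μ) * s i + (w3 - μ) * c i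
        + (w4 + κ * μ) * v₁ i + (w5 - κ * μ) * v₂ i := by
      intro μ _ i
      rw [h i]
      linear_combination μ * hc i
    by_cases c1 : a * w3 ≤ w1 ∧ κ * w3 ≤ w5
    · obtain ⟨c1, c2⟩ := c1
      obtain ⟨σ, hσ, hx⟩ := t3 x (comb_mem _ r s v₁ v₂ x (by simp [hr]) (by simp [hs]) (by simp) (by simp)
        (w1 - a * w3) (w2 + B * w3) (w4 + κ * w3) (w5 - κ * w3) (by linarith) (by positivity)
        (by positivity) (by linarith) (by linear_combination hsum + w3 * hAB)
        (fun i => by rw [red w3 h3 i]; ring))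
      exact ⟨σ, by simp [hσ], hx⟩
    by_cases c2 : κ * w1 ≤ a * w5
    · have hm : 0 ≤ w1 / a := by positivity
      have e1 : a * (w1 / a) = w1 := by field_simp
      refine ⟨{v₁, v₂, s, c}, by simp, comb_mem _ v₁ v₂ s c x (by simp) (by simp) (by simp) (by simp)
        (w4 + κ * (w1 / a)) (w5 - κ * (w1 / a)) (w2 + B * (w1 / a)) (w3 - w1 / a) (by positivity)
        ?_ (by positivity) ?_ (by linear_combination hsum + (w1 / a) * hAB + e1) ?_⟩
      · rw [sub_nonneg, ← mul_div_assoc, div_le_iff₀ ha]; linarith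
      · rw [sub_nonneg, div_le_iff₀ ha]
        by_contra hcon
        apply c1
        push Not at hcon
        refine ⟨by linarith, ?_⟩
        have : a * (κ * w3) ≤ a * w5 := by nlinarith
        exact le_of_mul_le_mul_left this ha
      · intro i
        rw [red (w1 / a) hm i, e1]; ring
    · push Not at c2
      have hm : 0 ≤ w5 / κ := by positivity
      have e1 : κ * (w5 / κ) = w5 := by field_simp
      refine ⟨{v₁, r, s, c}, by simp, comb_mem _ v₁ r s c x (by simp) (by simp) (by simp) (by simp)
        (w4 + κ * (w5 / κ)) (w1 - a * (w5 / κ)) (w2 + B * (w5 / κ)) (w3 - w5 / κ) (by positivity)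
        ?_ (by positivity) ?_ (by linear_combination hsum + (w5 / κ) * hAB + e1) ?_⟩
      · rw [sub_nonneg, ← mul_div_assoc, div_le_iff₀ hκ]; linarith
      · rw [sub_nonneg, div_le_iff₀ hκ]
        by_contra hcon
        apply c1
        push Not at hcon
        refine ⟨?_, by linarith⟩
        have : κ * (a * w3) ≤ κ * w1 := by nlinarith
        exact le_of_mul_le_mul_left this hκ
      · intro i
        rw [red (w5 / κ) hm i, e1]; ring
  · rw [Finset.card_insert_of_notMem, Finset.card_insert_of_notMem hnew]
    simp only [Finset.mem_insert, not_or]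
    exact ⟨hne12.symm, hnew2⟩

lemma cr_sub (e p q : Pt3) : cr e (p - q) = cr e p - cr e q := by
  simp [cr]; ring

lemma par_of_cr (e u : Pt3) (he2 : e 2 = 0) (he : e ≠ 0) (hu2 : u 2 = 0) (h : cr e u = 0) :
    ∃ k : ℝ, ∀ i, u i = k * e i := by
  have hpos : e 0 ^ 2 + e 1 ^ 2 ≠ 0 := by
    intro h0
    apply he
    have h1 : e 0 = 0 := by nlinarith
    have h2 : e 1 = 0 := by nlinarith
    ext i
    fin_cases i
    · exact h1
    · exact h2
    · exact he2
  unfold cr at h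
  refine ⟨(e 0 * u 0 + e 1 * u 1) / (e 0 ^ 2 + e 1 ^ 2), fun i => ?_⟩
  rw [div_mul_eq_mul_div, eq_div_iff hpos]
  fin_cases i
  · simp only [Fin.zero_eta]; linear_combination -(e 1) * h
  · simp only [Fin.mk_one]; linear_combination (e 0) * h
  · simp [he2, hu2]

/-- expression of `c` through `r`, `s` and the direction `e` -/
lemma express (e c r s : Pt3) (he2 : e 2 = 0) (he : e ≠ 0) (ec : c 2 = 0) (er : r 2 = 0)
    (es : s 2 = 0) (hrs : cr e s - cr e r ≠ 0) :
    ∃ κ : ℝ, ∀ i, c i = (1 - (cr e c - cr e r) / (cr e s - cr e r)) * r i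
      + ((cr e c - cr e r) / (cr e s - cr e r)) * s i - κ * e i := by
  set B := (cr e c - cr e r) / (cr e s - cr e r) with hB
  have hBm : B * (cr e s - cr e r) = cr e c - cr e r := by rw [hB]; field_simp
  obtain ⟨k, hk⟩ := par_of_cr e (c - (1 - B) • r - B • s) he2 he (by simp [ec, er, es]) (by
    simp only [cr, Pi.sub_apply, Pi.smul_apply, smul_eq_mul] at hBm ⊢
    linear_combination -hBm)
  refine ⟨-k, fun i => ?_⟩
  have := hk i
  simp only [Pi.sub_apply, Pi.smul_apply, smul_eq_mul] at this
  linarith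

lemma cone_cr (e q c r s : Pt3) (α β : ℝ) 
    (h : ∀ i, q i - c i = α * (r i - c i) + β * (s i - c i)) :
    cr e q - cr e c = α * (cr e r - cr e c) + β * (cr e s - cr e c) := by
  simp only [cr]
  linear_combination e 0 * h 1 - e 1 * h 0

lemma stepA' (S : Finset Pt3) (c v₁ v₂ : Pt3) (hcS : c ∉ S) (hpl : ∀ q ∈ insert c S, q 2 = 0)
    (hcp : CP (insert c S)) (hcard : 2 ≤ S.card) (hne : v₁ ≠ v₂)
    (hpar : v₁ 2 = v₂ 2) (hside : 0 < v₁ 2)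
    (hf : ∀ p ∈ insert c S, ∀ q ∈ insert c S, cr (v₂ - v₁) p = cr (v₂ - v₁) q → p = q)
    (a b : Pt3) (ha : a ∈ S) (hb : b ∈ S) (hac : cr (v₂ - v₁) a < cr (v₂ - v₁) c)
    (hcb : cr (v₂ - v₁) c < cr (v₂ - v₁) b)
    (T : Finset (Finset Pt3)) (hT : Pre (insert v₁ (insert v₂ S)) T) :
    ∃ T', Pre (insert v₁ (insert v₂ (insert c S))) T' ∧ T'.card = T.card + 1 := by
  obtain ⟨r, hr, s, hs, hrs, hcone⟩ := cone_lemma S c hcS hpl hcp hcard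
  have er := hpl r (by simp [hr])
  have es := hpl s (by simp [hs])
  have ec := hpl c (by simp)
  have he2 : (v₂ - v₁) 2 = 0 := by simp [hpar]
  have he : v₂ - v₁ ≠ 0 := sub_ne_zero.2 hne.symm
  have hfrs : cr (v₂ - v₁) s - cr (v₂ - v₁) r ≠ 0 := by
    intro h
    exact hrs (hf r (by simp [hr]) s (by simp [hs]) (by linarith))
  have hlow : cr (v₂ - v₁) r < cr (v₂ - v₁) c ∨ cr (v₂ - v₁) s < cr (v₂ - v₁) c := by
    by_contra hcon
    push Not at hcon
    by_cases h1 : a = r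
    · rw [h1] at hac; linarith
    by_cases h2 : a = s
    · rw [h2] at hac; linarith
    obtain ⟨α, β, hα, hβ, hαβ, h⟩ := hcone a ha h1 h2
    have := cone_cr (v₂ - v₁) a c r s α β h
    nlinarith [mul_nonneg hα (sub_nonneg.2 hcon.1), mul_nonneg hβ (sub_nonneg.2 hcon.2)]
  have hhigh : cr (v₂ - v₁) c < cr (v₂ - v₁) r ∨ cr (v₂ - v₁) c < cr (v₂ - v₁) s := by
    by_contra hcon
    push Not at hcon
    by_cases h1 : b = r
    · rw [h1] at hcb; linarith
    by_cases h2 : b = s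
    · rw [h2] at hcb; linarith
    obtain ⟨α, β, hα, hβ, hαβ, h⟩ := hcone b hb h1 h2
    have := cone_cr (v₂ - v₁) b c r s α β h
    nlinarith [mul_nonneg hα (sub_nonneg.2 hcon.1), mul_nonneg hβ (sub_nonneg.2 hcon.2)]
  obtain ⟨κ, hκ⟩ := express (v₂ - v₁) c r s he2 he ec er es hfrs
  set B := (cr (v₂ - v₁) c - cr (v₂ - v₁) r) / (cr (v₂ - v₁) s - cr (v₂ - v₁) r) with hBdef
  have hB : 0 ≤ B ∧ 0 ≤ 1 - B := by
    rcases hlow with h1 | h1 <;> rcases hhigh with h2 | h2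
    · linarith
    · rw [sub_nonneg, hBdef, div_le_one (by linarith)]
      exact ⟨div_nonneg (by linarith) (by linarith), by linarith⟩
    · rw [sub_nonneg, hBdef, div_le_one_of_neg (by linarith)]
      exact ⟨div_nonneg_of_nonpos (by linarith) (by linarith), by linarith⟩
    · linarith
  have hD : cr (s - r) (v₂ - v₁) ≠ 0 := by
    intro h
    apply hfrs
    simp only [cr, Pi.sub_apply] at h ⊢
    linarith
  rcases lt_trichotomy κ 0 with hk | hk | hk
  · have := stepA S c r s v₂ v₁ hr hs hcS hpl hcone hpar.symm (hpar ▸ hside) (1 - B) B (-κ) (by ring)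
      (by linarith) hB.2 hB.1 (fun i => by rw [hκ i]; simp only [Pi.sub_apply]; ring) (by
        intro h
        apply hD
        simp only [cr, Pi.sub_apply] at h ⊢
        linarith) T (by rw [Finset.insert_comm]; exact hT)
    rw [Finset.insert_comm]
    exact this
  · exfalso
    refine hcp.comb (q := c) (a := r) (b := s) (c := s) (by simp) (by simp [hr]) (by simp [hs])
      (by simp [hs]) (fun h => hcS (h ▸ hr)) (fun h => hcS (h ▸ hs)) (fun h => hcS (h ▸ hs))
      (1 - B) B 0 hB.2 hB.1 le_rfl (by ring) (fun i => ?_)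
    rw [hκ i, hk]; ring
  · exact stepA S c r s v₁ v₂ hr hs hcS hpl hcone hpar hside (1 - B) B κ (by ring)
      hk hB.2 hB.1 (fun i => by rw [hκ i]; simp only [Pi.sub_apply]) hD T hT

lemma stepB' (S : Finset Pt3) (c v₁ v₂ : Pt3) (hcS : c ∉ S) (hpl : ∀ q ∈ insert c S, q 2 = 0)
    (hcp : CP (insert c S)) (hcard : 2 ≤ S.card) (hne : v₁ ≠ v₂)
    (hpar : v₁ 2 = v₂ 2) (hside : 0 < v₁ 2)
    (hf : ∀ p ∈ insert c S, ∀ q ∈ insert c S, cr (v₂ - v₁) p = cr (v₂ - v₁) q → p = q)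
    (hmax : ∀ q ∈ S, cr (v₂ - v₁) q < cr (v₂ - v₁) c)
    (T : Finset (Finset Pt3)) (hT : Pre (insert v₁ (insert v₂ S)) T) :
    ∃ T', Pre (insert v₁ (insert v₂ (insert c S))) T' ∧ T'.card = T.card + 2 := by
  obtain ⟨r, hr, s, hs, hrs', hcone⟩ : ∃ r ∈ S, ∃ s ∈ S, cr (v₂ - v₁) r < cr (v₂ - v₁) s ∧
      ∀ q ∈ S, q ≠ r → q ≠ s → ∃ α β : ℝ, 0 ≤ α ∧ 0 ≤ β ∧ 1 < α + β ∧
      ∀ i, q i - c i = α * (r i - c i) + β * (s i - c i) := by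
    obtain ⟨r, hr, s, hs, hrs, hcone⟩ := cone_lemma S c hcS hpl hcp hcard
    rcases lt_trichotomy (cr (v₂ - v₁) r) (cr (v₂ - v₁) s) with h | h | h
    · exact ⟨r, hr, s, hs, h, hcone⟩
    · exact absurd (hf r (by simp [hr]) s (by simp [hs]) h) hrs
    · refine ⟨s, hs, r, hr, h, fun q hq h1 h2 => ?_⟩
      obtain ⟨α, β, hα, hβ, hαβ, h⟩ := hcone q hq h2 h1
      exact ⟨β, α, hβ, hα, by linarith, fun i => by rw [h i]; ring⟩
  have hrs : r ≠ s := by rintro rfl; exact lt_irrefl _ hrs'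
  have er := hpl r (by simp [hr])
  have es := hpl s (by simp [hs])
  have ec := hpl c (by simp)
  have he2 : (v₂ - v₁) 2 = 0 := by simp [hpar]
  have he : v₂ - v₁ ≠ 0 := sub_ne_zero.2 hne.symm
  have hfrs : cr (v₂ - v₁) s - cr (v₂ - v₁) r ≠ 0 := by
    intro h
    linarith
  have hsc := hmax s hs
  have hrc := hmax r hr
  have hSs : ∀ q ∈ S, q ≠ s → cr (v₂ - v₁) q < cr (v₂ - v₁) s := by
    intro q hq hqs
    by_cases hqr : q = r
    · rw [hqr]; exact hrs'
    obtain ⟨α, β, hα, hβ, hαβ, h⟩ := hcone q hq hqr hqs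
    have := cone_cr (v₂ - v₁) q c r s α β h
    nlinarith
  obtain ⟨κ, hκ⟩ := express (v₂ - v₁) c r s he2 he ec er es hfrs
  set B := (cr (v₂ - v₁) c - cr (v₂ - v₁) r) / (cr (v₂ - v₁) s - cr (v₂ - v₁) r) with hBdef
  have hB : 1 < B := by
    rw [hBdef, one_lt_div (by linarith)]
    linarith
  have hD : cr (s - r) (v₂ - v₁) ≠ 0 := by
    intro h
    apply hfrs
    simp only [cr, Pi.sub_apply] at h ⊢
    linarith
  have hD2 : cr (v₂ - v₁) (c - s) ≠ 0 := by
    rw [cr_sub]; intro h; linarith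
  -- the vertical plane functional
  obtain ⟨H, l, Hv1, Hv2, HH⟩ : ∃ (H : Pt3 →ₗ[ℝ] ℝ) (l : ℝ), H v₁ = l ∧ H v₂ = l ∧
      ∀ q, q 2 = 0 → H q = l + cr (v₂ - v₁) s - cr (v₂ - v₁) q := by
    refine ⟨lf (v₂ 1 - v₁ 1) (-(v₂ 0 - v₁ 0)) ((cr (v₂ - v₁) v₁ - cr (v₂ - v₁) s) / v₁ 2),
      - cr (v₂ - v₁) s, ?_, ?_, ?_⟩
    · rw [lf_apply, div_mul_cancel₀ _ hside.ne']
      simp only [cr, Pi.sub_apply]; ring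
    · rw [lf_apply, ← hpar, div_mul_cancel₀ _ hside.ne']
      simp only [cr, Pi.sub_apply]; ring
    · intro q hq
      rw [lf_apply, hq]
      simp only [cr, Pi.sub_apply]; ring
  have Hs : H s = l := by rw [HH s es]; ring
  have Hc : H c < l := by rw [HH c ec]; linarith
  have HS : ∀ q ∈ S, q ≠ s → l < H q := by
    intro q hq hqs
    rw [HH q (hpl q (by simp [hq]))]
    linarith [hSs q hq hqs]
  rcases lt_trichotomy κ 0 with hk | hk | hk
  · have := stepB S c r s v₂ v₁ hr hs hcS hpl hcone hpar.symm (hpar ▸ hside) (1 - B) B (-κ) (by ring)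
      (by linarith) (by linarith) (fun i => by rw [hκ i]; simp only [Pi.sub_apply]; ring) (by
        intro h
        apply hD
        simp only [cr, Pi.sub_apply] at h ⊢
        linarith) H l Hv2 Hv1 Hs Hc HS (by
        intro h
        apply hD2
        simp only [cr, Pi.sub_apply] at h ⊢
        linarith) T (by rw [Finset.insert_comm]; exact hT)
    rw [Finset.insert_comm]
    exact this
  · exfalso
    have hsc' : s ≠ c := fun h => hcS (h ▸ hs)
    refine hcp.comb (q := s) (a := r) (b := c) (c := c) (by simp [hs]) (by simp [hr]) (by simp)
      (by simp) hrs.symm hsc' hsc'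
      ((B - 1) / B) (1 / B) 0 (div_nonneg (by linarith) (by linarith))
      (div_nonneg (by linarith) (by linarith)) le_rfl ?_ (fun i => ?_)
    · have : B ≠ 0 := by linarith
      field_simp; ring
    · have hB0 : B ≠ 0 := by linarith
      have := hκ i
      rw [hk] at this
      rw [this]
      clear_value B
      field_simp; ring
  · exact stepB S c r s v₁ v₂ hr hs hcS hpl hcone hpar hside (1 - B) B κ (by ring)
      hk (by linarith) (fun i => by rw [hκ i]; simp only [Pi.sub_apply]) hD H l Hv1 Hv2 Hs Hc HS hD2 T hT

lemma base_tri (a b v₁ v₂ : Pt3) (ea : a 2 = 0) (eb : b 2 = 0) (hpar : v₁ 2 = v₂ 2)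
    (hside : 0 < v₁ 2) (h : cr (v₂ - v₁) b ≠ cr (v₂ - v₁) a) :
    Pre (insert v₁ (insert v₂ {a, b})) {{v₁, v₂, a, b}} := by
  refine ⟨?_, ?_, ?_⟩
  · intro σ hσ
    rw [Finset.mem_singleton] at hσ
    subst hσ
    exact ⟨tet_vv a b v₁ v₂ ea eb hpar hside (by rw [cr_sub]; exact sub_ne_zero.2 h),
      Finset.Subset.refl _⟩
  · intro σ hσ τ hτ
    rw [Finset.mem_singleton] at hσ hτ
    subst hσ
    subst hτ
    simp
  · intro x hx
    exact ⟨_, Finset.mem_singleton_self _, hx⟩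

lemma exists_min (S : Finset Pt3) (a b v₁ v₂ : Pt3) (hne : v₁ ≠ v₂) (hpar : v₁ 2 = v₂ 2)
    (hside : 0 < v₁ 2) (hab : cr (v₂ - v₁) a < cr (v₂ - v₁) b) :
    (∀ q ∈ S, cr (v₂ - v₁) a < cr (v₂ - v₁) q ∧ cr (v₂ - v₁) q < cr (v₂ - v₁) b) →
    (∀ q ∈ S ∪ {a, b}, q 2 = 0) → CP (S ∪ {a, b}) →
    (∀ p ∈ S ∪ {a, b}, ∀ q ∈ S ∪ {a, b}, cr (v₂ - v₁) p = cr (v₂ - v₁) q → p = q) →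
    ∃ T, Pre (insert v₁ (insert v₂ (S ∪ {a, b}))) T ∧ T.card = S.card + 1 := by
  induction S using Finset.induction_on with
  | empty =>
    intro _ hpl _ _
    refine ⟨{{v₁, v₂, a, b}}, ?_, by simp⟩
    rw [Finset.empty_union]
    exact base_tri a b v₁ v₂ (hpl a (by simp)) (hpl b (by simp)) hpar hside hab.ne'
  | insert c S hcS ih =>
    intro hbet hpl hcp hf
    have hsub : S ∪ {a, b} ⊆ insert c S ∪ {a, b} := by
      intro y hy; simp at hy ⊢; tauto
    obtain ⟨T, hT, hTc⟩ := ih (fun q hq => hbet q (by simp [hq])) (fun q hq => hpl q (hsub hq))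
      (hcp.mono hsub) (fun p hp q hq => hf p (hsub hp) q (hsub hq))
    obtain ⟨h1, h2⟩ := hbet c (by simp)
    rw [Finset.insert_union] at *
    have hne' : a ≠ b := by rintro rfl; exact lt_irrefl _ hab
    obtain ⟨T', hT', hc'⟩ := stepA' (S ∪ {a, b}) c v₁ v₂ (by
        simp only [Finset.mem_union, Finset.mem_insert, Finset.mem_singleton, not_or]
        refine ⟨hcS, ?_, ?_⟩
        · rintro rfl; exact lt_irrefl _ h1
        · rintro rfl; exact lt_irrefl _ h2) hpl hcp
      (by
        rw [← Finset.card_pair hne']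
        exact Finset.card_le_card Finset.subset_union_right) hne hpar hside hf a b (by simp) (by simp)
      h1 h2 T hT
    refine ⟨T', hT', ?_⟩
    rw [hc', hTc, Finset.card_insert_of_notMem hcS]

lemma exists_max (S : Finset Pt3) (v₁ v₂ : Pt3) (hne : v₁ ≠ v₂) (hpar : v₁ 2 = v₂ 2)
    (hside : 0 < v₁ 2) :
    (∀ q ∈ S, q 2 = 0) → CP S →
    (∀ p ∈ S, ∀ q ∈ S, cr (v₂ - v₁) p = cr (v₂ - v₁) q → p = q) → 2 ≤ S.card → 
    ∃ T, Pre (insert v₁ (insert v₂ S)) T ∧ T.card + 3 = 2 * S.card := by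
  induction S using Finset.induction_on_max_value (fun q => cr (v₂ - v₁) q) with
  | empty => intro _ _ _ h; simp at h
  | insert c S hcS hmax ih =>
    intro hpl hcp hf hcard
    have hmax' : ∀ q ∈ S, cr (v₂ - v₁) q < cr (v₂ - v₁) c := by
      intro q hq
      refine lt_of_le_of_ne (hmax q hq) (fun h => ?_)
      have := hf q (by simp [hq]) c (by simp) h
      exact hcS (this ▸ hq)
    rw [Finset.card_insert_of_notMem hcS] at hcard ⊢
    by_cases h2 : 2 ≤ S.card
    · have hsub : S ⊆ insert c S := Finset.subset_insert _ _
      obtain ⟨T, hT, hTc⟩ := ih (fun q hq => hpl q (hsub hq))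
        (hcp.mono hsub) (fun p hp q hq => hf p (hsub hp) q (hsub hq)) h2
      obtain ⟨T', hT', hc'⟩ := stepB' S c v₁ v₂ hcS hpl hcp h2 hne hpar hside hf hmax' T hT
      exact ⟨T', hT', by omega⟩
    · have h1 : S.card = 1 := by omega
      obtain ⟨a, rfl⟩ := Finset.card_eq_one.1 h1
      refine ⟨{{v₁, v₂, c, a}}, ?_, by simp⟩
      exact base_tri c a v₁ v₂ (hpl c (by simp)) (hpl a (by simp)) hpar hside
        (hmax' a (by simp)).ne

lemma tet_not_flat (σ : Finset Pt3) (h : IsTet σ) (hpl : ∀ q ∈ σ, q 2 = 0) : False := by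
  obtain ⟨hc, hai⟩ := h
  have h1 := hai.finrank_vectorSpan (n := 3) (by simp [hc])
  rw [Subtype.range_coe] at h1
  have h2 : vectorSpan ℝ (σ : Set Pt3) = ⊤ := by
    apply Submodule.eq_top_of_finrank_eq
    rw [h1]; simp
  have h3 : vectorSpan ℝ (σ : Set Pt3) ≤ LinearMap.ker (LinearMap.proj 2 : Pt3 →ₗ[ℝ] ℝ) := by
    rw [vectorSpan_def, Submodule.span_le]
    rintro _ ⟨p, hp, q, hq, rfl⟩
    simp [hpl p hp, hpl q hq]
  rw [h2] at h3
  have : (Pi.single 2 1 : Pt3) ∈ LinearMap.ker (LinearMap.proj 2 : Pt3 →ₗ[ℝ] ℝ) := h3 trivial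
  simp at this

/-- points of height zero use only vertices of height zero -/
lemma flat (σ Q : Finset Pt3) (hnn : ∀ p ∈ σ, p ∉ Q → 0 < p 2) (hpl : ∀ q ∈ Q, q 2 = 0)
    (x : Pt3) (hx : x ∈ convexHull ℝ (σ : Set Pt3)) (hx2 : x 2 = 0) :
    ∃ w : Pt3 → ℝ, (∀ p ∈ σ, 0 ≤ w p) ∧ ∑ p ∈ σ, w p = 1 ∧ ∑ p ∈ σ, w p • p = x ∧
      ∀ p ∈ σ, p ∉ Q → w p = 0 := by
  rw [Finset.mem_convexHull'] at hx
  obtain ⟨w, hw0, hw1, hwx⟩ := hx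
  refine ⟨w, hw0, hw1, hwx, ?_⟩
  have h0 : ∀ p ∈ σ, 0 ≤ p 2 := by
    intro p hp
    by_cases h : p ∈ Q
    · rw [hpl p h]
    · exact (hnn p hp h).le
  have hs : ∑ p ∈ σ, w p * p 2 = 0 := by
    rw [← hx2, ← hwx]; simp
  rw [Finset.sum_eq_zero_iff_of_nonneg (fun p hp => mul_nonneg (hw0 p hp) (h0 p hp))] at hs
  intro p hp hpQ
  exact (mul_eq_zero.1 (hs p hp)).resolve_right (hnn p hp hpQ).ne'

lemma flat_lt (σ Q : Finset Pt3) (hnn : ∀ p ∈ σ, p ∉ Q → 0 < p 2) (hpl : ∀ q ∈ Q, q 2 = 0)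
    (x : Pt3) (hx : x ∈ convexHull ℝ (σ : Set Pt3)) (hx2 : x 2 = 0) (F : Pt3 →ₗ[ℝ] ℝ) (q : Pt3)
    (hF : ∀ p ∈ Q, F p = F q → p = q) (hxF : F x = F q) (hxq : x ≠ q) :
    ∃ a ∈ σ, a ∈ Q ∧ F a < F q := by
  obtain ⟨w, hw0, hw1, hwx, hwQ⟩ := flat σ Q hnn hpl x hx hx2
  by_contra hcon
  push Not at hcon
  apply hxq
  have hnn' : ∀ p ∈ σ, 0 ≤ w p * (F p - F q) := by
    intro p hp
    by_cases h : p ∈ Q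
    · exact mul_nonneg (hw0 p hp) (sub_nonneg.2 (hcon p hp h))
    · simp [hwQ p hp h]
  have hs : ∑ p ∈ σ, w p * (F p - F q) = 0 := by
    have : ∑ p ∈ σ, w p * (F p - F q) = F x - F q := by
      rw [← hwx, map_sum]
      simp only [map_smul, smul_eq_mul, mul_sub, Finset.sum_sub_distrib, ← Finset.sum_mul, hw1, one_mul]
    rw [this, hxF, sub_self]
  rw [Finset.sum_eq_zero_iff_of_nonneg hnn'] at hs
  have hpq : ∀ p ∈ σ, w p • p = w p • q := by
    intro p hp
    rcases mul_eq_zero.1 (hs p hp) with h | h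
    · simp [h]
    · by_cases hpQ : p ∈ Q
      · rw [hF p hpQ (by linarith)]
      · simp [hwQ p hp hpQ]
  rw [← hwx, Finset.sum_congr rfl hpq, ← Finset.sum_smul, hw1, one_smul]

/-- the functional `cr e` as a linear map -/
def crL (e : Pt3) : Pt3 →ₗ[ℝ] ℝ := lf (-(e 1)) (e 0) 0

lemma crL_apply (e x : Pt3) : crL e x = cr e x := by
  rw [crL, lf_apply, cr]; ring

lemma flat_between (σ Q : Finset Pt3) (hnn : ∀ p ∈ σ, p ∉ Q → 0 < p 2) (hpl : ∀ q ∈ Q, q 2 = 0)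
    (x : Pt3) (hx : x ∈ convexHull ℝ (σ : Set Pt3)) (hx2 : x 2 = 0) (e : Pt3) (q : Pt3)
    (hF : ∀ p ∈ Q, cr e p = cr e q → p = q) (hxF : cr e x = cr e q) (hxq : x ≠ q) :
    (∃ a ∈ σ, a ∈ Q ∧ cr e a < cr e q) ∧ (∃ b ∈ σ, b ∈ Q ∧ cr e q < cr e b) := by
  constructor
  · obtain ⟨a, h1, h2, h3⟩ := flat_lt σ Q hnn hpl x hx hx2 (crL e) q
      (by simpa only [crL_apply] using hF) (by simpa only [crL_apply] using hxF) hxq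
    exact ⟨a, h1, h2, by simpa only [crL_apply] using h3⟩
  · obtain ⟨a, h1, h2, h3⟩ := flat_lt σ Q hnn hpl x hx hx2 (-crL e) q
      (by simpa only [LinearMap.neg_apply, crL_apply, neg_inj] using hF)
      (by simpa only [LinearMap.neg_apply, crL_apply, neg_inj] using hxF) hxq
    exact ⟨a, h1, h2, by simpa only [LinearMap.neg_apply, crL_apply, neg_lt_neg_iff] using h3⟩

/-- common point of two tetrahedra over the same base triangle -/
lemma overlap (a q b v₁ v₂ : Pt3) (ea : a 2 = 0) (eq : q 2 = 0) (eb : b 2 = 0)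
    (hside : 0 < v₁ 2) (B κ : ℝ) (hB : 0 ≤ B) (hB1 : 0 ≤ 1 - B) (hκ : 0 < κ)
    (h : ∀ i, q i = (1 - B) * a i + B * b i - κ * (v₂ i - v₁ i)) :
    ∃ x : Pt3, 0 < x 2 ∧ x ∈ convexHull ℝ (({v₁, a, q, b} : Finset Pt3) : Set Pt3) ∧
      x ∈ convexHull ℝ (({v₂, a, q, b} : Finset Pt3) : Set Pt3) := by
  set t := κ / (1 + κ) with ht
  have ht0 : 0 < t := by positivity
  have ht1 : 0 < 1 - t := by rw [ht]; field_simp; norm_num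
  have htk : (1 - t) * κ = t := by rw [ht]; field_simp; ring
  refine ⟨(1 - t) • ((1 - B) • a + B • b) + t • v₁, ?_, ?_, ?_⟩
  · simp [ea, eb]; positivity
  · refine comb_mem _ v₁ a q b _ (by simp) (by simp) (by simp) (by simp) t ((1 - t) * (1 - B)) 0
      ((1 - t) * B) ht0.le (by positivity) le_rfl (by positivity) (by ring) (fun i => ?_)
    simp only [Pi.add_apply, Pi.smul_apply, smul_eq_mul]
    ring
  · refine comb_mem _ v₂ a q b _ (by simp) (by simp) (by simp) (by simp) t 0 (1 - t)
      0 ht0.le le_rfl ht1.le le_rfl (by ring) (fun i => ?_)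
    simp only [Pi.add_apply, Pi.smul_apply, smul_eq_mul]
    linear_combination -(1 - t) * h i - (v₁ i - v₂ i) * htk

/-- `q` is the middle vertex of the base triangle of `σ` -/
def Mid (Q : Finset Pt3) (e : Pt3) (σ : Finset Pt3) (q : Pt3) : Prop :=
  q ∈ σ ∧ q ∈ Q ∧ (∃ a ∈ σ, a ∈ Q ∧ cr e a < cr e q) ∧ (∃ b ∈ σ, b ∈ Q ∧ cr e q < cr e b)

section bounds

/-- standing assumptions for the counting bounds -/
structure Setup (Q : Finset Pt3) (v₁ v₂ : Pt3) (T : Finset (Finset Pt3)) : Prop where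
  hpl : ∀ q ∈ Q, q 2 = 0
  hcp : CP Q
  hne : v₁ ≠ v₂
  hpar : v₁ 2 = v₂ 2
  hside : 0 < v₁ 2
  hf : ∀ p ∈ Q, ∀ q ∈ Q, cr (v₂ - v₁) p = cr (v₂ - v₁) q → p = q
  hT : IsTriangulation (insert v₁ (insert v₂ Q)) T

variable {Q : Finset Pt3} {v₁ v₂ : Pt3} {T : Finset (Finset Pt3)}

lemma Setup.sub (h : Setup Q v₁ v₂ T) {σ : Finset Pt3} (hσ : σ ∈ T) {p : Pt3} (hp : p ∈ σ) :
    p = v₁ ∨ p = v₂ ∨ p ∈ Q := by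
  have := (h.hT.1.1 σ hσ).2 hp
  simpa using this

lemma Setup.pos (h : Setup Q v₁ v₂ T) {σ : Finset Pt3} (hσ : σ ∈ T) : 
    ∀ p ∈ σ, p ∉ Q → 0 < p 2 := by
  intro p hp hpQ
  rcases h.sub hσ hp with rfl | rfl | h'
  · exact h.hside
  · rw [← h.hpar]; exact h.hside
  · exact absurd h' hpQ

lemma Setup.v1Q (h : Setup Q v₁ v₂ T) : v₁ ∉ Q := by
  intro hq
  have := h.hpl _ hq
  linarith [h.hside]

lemma Setup.v2Q (h : Setup Q v₁ v₂ T) : v₂ ∉ Q := by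
  intro hq
  have := h.hpl _ hq
  linarith [h.hside, h.hpar]

lemma Setup.he2 (h : Setup Q v₁ v₂ T) : (v₂ - v₁) 2 = 0 := by simp [h.hpar]

lemma Setup.he (h : Setup Q v₁ v₂ T) : v₂ - v₁ ≠ 0 := sub_ne_zero.2 h.hne.symm

lemma Setup.inter (h : Setup Q v₁ v₂ T) {σ τ : Finset Pt3} (hσ : σ ∈ T) (hτ : τ ∈ T) {x : Pt3}
    (h1 : x ∈ convexHull ℝ (σ : Set Pt3)) (h2 : x ∈ convexHull ℝ (τ : Set Pt3)) :
    x ∈ convexHull ℝ ((σ ∩ τ : Finset Pt3) : Set Pt3) := by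
  rw [← h.hT.2 σ hσ τ hτ]; exact ⟨h1, h2⟩

/-- between two points of `Q` -/
lemma Setup.between (h : Setup Q v₁ v₂ T) {a q b : Pt3} (ha : a ∈ Q) (hq : q ∈ Q) (hb : b ∈ Q)
    (haq : cr (v₂ - v₁) a < cr (v₂ - v₁) q) (hqb : cr (v₂ - v₁) q < cr (v₂ - v₁) b) :
    ∃ B κ : ℝ, 0 ≤ B ∧ 0 ≤ 1 - B ∧ κ ≠ 0 ∧
      ∀ i, q i = (1 - B) * a i + B * b i - κ * (v₂ i - v₁ i) := by
  obtain ⟨κ, hκ⟩ := express (v₂ - v₁) q a b h.he2 h.he (h.hpl q hq) (h.hpl a ha) (h.hpl b hb)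
    (by intro h; linarith)
  have h1 : 0 ≤ (cr (v₂ - v₁) q - cr (v₂ - v₁) a) / (cr (v₂ - v₁) b - cr (v₂ - v₁) a) :=
    div_nonneg (by linarith) (by linarith)
  have h2 : 0 ≤ 1 - (cr (v₂ - v₁) q - cr (v₂ - v₁) a) / (cr (v₂ - v₁) b - cr (v₂ - v₁) a) := by
    rw [sub_nonneg, div_le_one (by linarith)]; linarith
  refine ⟨_, κ, h1, h2, ?_, hκ⟩
  rintro rfl
  have qa : q ≠ a := by rintro rfl; exact lt_irrefl _ haq
  have qb : q ≠ b := by rintro rfl; exact lt_irrefl _ hqb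
  refine h.hcp.comb hq ha hb hb qa qb qb _ _ 0 h2 h1 le_rfl (by ring) (fun i => ?_)
  have := hκ i
  linarith

lemma Setup.exists_mid (h : Setup Q v₁ v₂ T) {a q b : Pt3} (ha : a ∈ Q) (hq : q ∈ Q) (hb : b ∈ Q)
    (haq : cr (v₂ - v₁) a < cr (v₂ - v₁) q) (hqb : cr (v₂ - v₁) q < cr (v₂ - v₁) b) :
    ∃ σ ∈ T, Mid Q (v₂ - v₁) σ q := by
  obtain ⟨B, κ, hB, hB1, hκ, hi⟩ := h.between ha hq hb haq hqb
  have hev : ∀ᶠ t in nhdsWithin (0 : ℝ) (Set.Ioi 0), ∀ σ ∈ T,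
      q + t • (κ • (v₂ - v₁)) ∈ convexHull ℝ (σ : Set Pt3) → q ∈ convexHull ℝ (σ : Set Pt3) := by
    rw [Filter.eventually_all_finset]
    intro σ _
    by_cases hqσ : q ∈ convexHull ℝ (σ : Set Pt3)
    · exact Filter.Eventually.of_forall (fun _ _ => hqσ)
    have hcl : IsClosed (convexHull ℝ (σ : Set Pt3)) := (σ.finite_toSet.isCompact_convexHull ℝ).isClosed
    have hcont : Continuous (fun t : ℝ => q + t • (κ • (v₂ - v₁))) := by fun_prop
    have : (fun t : ℝ => q + t • (κ • (v₂ - v₁))) ⁻¹' (convexHull ℝ (σ : Set Pt3))ᶜ ∈ nhds (0 : ℝ) :=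
      (hcl.isOpen_compl.preimage hcont).mem_nhds (by simpa using hqσ)
    have := nhdsWithin_le_nhds (s := Set.Ioi (0 : ℝ)) this
    filter_upwards [this] with t ht h'
    exact absurd h' ht
  have hlt : ∀ᶠ t in nhdsWithin (0 : ℝ) (Set.Ioi 0), t ∈ Set.Ioo (0 : ℝ) 1 :=
    Ioo_mem_nhdsGT one_pos
  obtain ⟨t, ht, ht0, ht1⟩ := (hev.and hlt).exists
  set x := q + t • (κ • (v₂ - v₁)) with hx
  have hxi : ∀ i, x i = q i + t * (κ * (v₂ i - v₁ i)) := by intro i; simp [hx]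
  have hxV : x ∈ convexHull ℝ ((insert v₁ (insert v₂ Q) : Finset Pt3) : Set Pt3) := by
    refine comb_mem _ a q b b x (by simp [ha]) (by simp [hq]) (by simp [hb]) (by simp [hb])
      (t * (1 - B)) (1 - t) (t * B) 0 (by positivity) (by linarith) (by positivity) le_rfl (by ring)
      (fun i => ?_)
    rw [hxi i]
    linear_combination t * hi i
  rw [← h.hT.1.2.2] at hxV
  simp only [Set.mem_iUnion] at hxV
  obtain ⟨σ, hσ, hxσ⟩ := hxV
  have hqσ := ht σ hσ hxσ
  have he2 := h.he2
  simp only [Pi.sub_apply] at he2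
  have hx2 : x 2 = 0 := by rw [hxi 2, he2, h.hpl q hq]; ring
  have hqm : q ∈ σ := by
    by_contra hqn
    obtain ⟨w, hw0, hw1, hwx, hwQ⟩ := flat σ Q (h.pos hσ) h.hpl q hqσ (h.hpl q hq)
    apply h.hcp q hq
    have e1 : ∑ p ∈ σ, w p • p = ∑ p ∈ σ ∩ Q, w p • p := by
      symm
      apply Finset.sum_subset Finset.inter_subset_left
      intro p hp hpn
      rw [hwQ p hp (fun hh => hpn (Finset.mem_inter.2 ⟨hp, hh⟩)), zero_smul]
    have e2 : ∑ p ∈ σ, w p = ∑ p ∈ σ ∩ Q, w p := by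
      symm
      apply Finset.sum_subset Finset.inter_subset_left
      intro p hp hpn
      rw [hwQ p hp (fun hh => hpn (Finset.mem_inter.2 ⟨hp, hh⟩))]
    have hm := (convex_convexHull ℝ ((Q.erase q : Finset Pt3) : Set Pt3)).sum_mem (t := σ ∩ Q)
      (w := w) (z := fun p => p) (fun p hp => hw0 p (Finset.mem_inter.1 hp).1) (by rw [← e2, hw1])
      (fun p hp => subset_convexHull ℝ _ (by
        have := Finset.mem_inter.1 hp
        simp only [Finset.coe_erase, Set.mem_sdiff, Set.mem_singleton_iff, Finset.mem_coe]
        exact ⟨this.2, fun hh => hqn (hh ▸ this.1)⟩))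
    rw [hwx] at e1
    convert hm using 1
  have hxq : x ≠ q := by
    intro hxq
    apply h.he
    ext i
    have := hxi i
    rw [hxq] at this
    have h0 : t * κ * (v₂ i - v₁ i) = 0 := by linarith
    simpa [ht0.ne', hκ] using h0
  have hb' := flat_between σ Q (h.pos hσ) h.hpl x hxσ hx2 (v₂ - v₁) q
    (fun p hp => h.hf p hp q hq) (by
      simp only [cr, hxi, Pi.sub_apply]; ring) hxq
  exact ⟨σ, hσ, hqm, hq, hb'.1, hb'.2⟩

lemma Setup.mid_unique (h : Setup Q v₁ v₂ T) {σ : Finset Pt3} (hσ : σ ∈ T) {q q' : Pt3}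
    (h1 : Mid Q (v₂ - v₁) σ q) (h2 : Mid Q (v₂ - v₁) σ q') : q = q' := by
  have main : ∀ q q', Mid Q (v₂ - v₁) σ q → Mid Q (v₂ - v₁) σ q' →
      ¬ (cr (v₂ - v₁) q < cr (v₂ - v₁) q') := by
    rintro q q' ⟨hq, hqQ, ⟨a, ha, haQ, haq⟩, _⟩ ⟨hq', hqQ', _, ⟨b, hb, hbQ, hqb⟩⟩ hlt
    have hc : ({a, q, q', b} : Finset Pt3).card = 4 := by
      have d1 : a ≠ q := by rintro rfl; linarith
      have d2 : a ≠ q' := by rintro rfl; linarith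
      have d3 : a ≠ b := by rintro rfl; linarith
      have d4 : q ≠ q' := by rintro rfl; linarith
      have d5 : q ≠ b := by rintro rfl; linarith
      have d6 : q' ≠ b := by rintro rfl; linarith
      rw [Finset.card_insert_of_notMem, Finset.card_insert_of_notMem, Finset.card_insert_of_notMem,
        Finset.card_singleton] <;> simp [*]
    have hs : ({a, q, q', b} : Finset Pt3) ⊆ σ := by
      intro y hy
      simp only [Finset.mem_insert, Finset.mem_singleton] at hy
      rcases hy with rfl | rfl | rfl | rfl <;> assumption
    have heq := Finset.eq_of_subset_of_card_le hs (by rw [hc, (h.hT.1.1 σ hσ).1.1])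
    refine tet_not_flat σ (h.hT.1.1 σ hσ).1 (fun p hp => h.hpl p ?_)
    rw [← heq] at hp
    simp only [Finset.mem_insert, Finset.mem_singleton] at hp
    rcases hp with rfl | rfl | rfl | rfl <;> assumption
  rcases lt_trichotomy (cr (v₂ - v₁) q) (cr (v₂ - v₁) q') with hl | hl | hl
  · exact absurd hl (main q q' h1 h2)
  · exact h.hf q h1.2.1 q' h2.2.1 hl
  · exact absurd hl (main q' q h2 h1)

lemma Setup.shape (h : Setup Q v₁ v₂ T) {σ : Finset Pt3} (hσ : σ ∈ T) {a q b : Pt3}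
    (ha : a ∈ σ) (haQ : a ∈ Q) (hq : q ∈ σ) (hqQ : q ∈ Q) (hb : b ∈ σ) (hbQ : b ∈ Q)
    (haq : cr (v₂ - v₁) a < cr (v₂ - v₁) q) (hqb : cr (v₂ - v₁) q < cr (v₂ - v₁) b) :
    σ = {v₁, a, q, b} ∨ σ = {v₂, a, q, b} := by
  obtain ⟨v, hv, hvQ⟩ : ∃ v ∈ σ, v ∉ Q := by
    by_contra hcon
    push Not at hcon
    exact tet_not_flat σ (h.hT.1.1 σ hσ).1 (fun p hp => h.hpl p (hcon p hp))
  have hc : ({v, a, q, b} : Finset Pt3).card = 4 := by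
    have d1 : a ≠ q := by rintro rfl; linarith
    have d3 : a ≠ b := by rintro rfl; linarith
    have d5 : q ≠ b := by rintro rfl; linarith
    have d6 : v ≠ a := by rintro rfl; exact hvQ haQ
    have d7 : v ≠ q := by rintro rfl; exact hvQ hqQ
    have d8 : v ≠ b := by rintro rfl; exact hvQ hbQ
    rw [Finset.card_insert_of_notMem, Finset.card_insert_of_notMem, Finset.card_insert_of_notMem,
      Finset.card_singleton] <;> simp [*]
  have hs : ({v, a, q, b} : Finset Pt3) ⊆ σ := by
    intro y hy
    simp only [Finset.mem_insert, Finset.mem_singleton] at hy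
    rcases hy with rfl | rfl | rfl | rfl <;> assumption
  have heq := Finset.eq_of_subset_of_card_le hs (by rw [hc, (h.hT.1.1 σ hσ).1.1])
  rcases h.sub hσ hv with rfl | rfl | hh
  · exact Or.inl heq.symm
  · exact Or.inr heq.symm
  · exact absurd hh hvQ

lemma Setup.mid_not_both (h : Setup Q v₁ v₂ T) {σ : Finset Pt3} (hσ : σ ∈ T) {q : Pt3}
    (h1 : Mid Q (v₂ - v₁) σ q) : ¬ (v₁ ∈ σ ∧ v₂ ∈ σ) := by
  rintro ⟨m1, m2⟩
  obtain ⟨hq, hqQ, ⟨a, ha, haQ, haq⟩, ⟨b, hb, hbQ, hqb⟩⟩ := h1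
  have w1 := h.v1Q
  have w2 := h.v2Q
  rcases h.shape hσ ha haQ hq hqQ hb hbQ haq hqb with hs | hs
  · rw [hs] at m2
    simp only [Finset.mem_insert, Finset.mem_singleton] at m2
    rcases m2 with hh | hh | hh | hh
    · exact h.hne hh.symm
    all_goals rw [hh] at w2; contradiction
  · rw [hs] at m1
    simp only [Finset.mem_insert, Finset.mem_singleton] at m1
    rcases m1 with hh | hh | hh | hh
    · exact h.hne hh
    all_goals rw [hh] at w1; contradiction

/-- no two different tetrahedra over the same base triangle -/
lemma Setup.no_overlap (h : Setup Q v₁ v₂ T) {a q b : Pt3} (haQ : a ∈ Q) (hqQ : q ∈ Q) (hbQ : b ∈ Q)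
    (haq : cr (v₂ - v₁) a < cr (v₂ - v₁) q) (hqb : cr (v₂ - v₁) q < cr (v₂ - v₁) b)
    (hσ : {v₁, a, q, b} ∈ T) (hτ : {v₂, a, q, b} ∈ T) : False := by
  obtain ⟨B, κ, hB, hB1, hκ, hi⟩ := h.between haQ hqQ hbQ haq hqb
  have w1 := h.v1Q
  have w2 := h.v2Q
  have hflat : ∀ x ∈ convexHull ℝ ((({v₁, a, q, b} : Finset Pt3) ∩ {v₂, a, q, b} : Finset Pt3) : Set Pt3),
      (LinearMap.proj 2 : Pt3 →ₗ[ℝ] ℝ) x ≤ 0 := by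
    have : convexHull ℝ ((({v₁, a, q, b} : Finset Pt3) ∩ {v₂, a, q, b} : Finset Pt3) : Set Pt3) ⊆
        {x | (LinearMap.proj 2 : Pt3 →ₗ[ℝ] ℝ) x ≤ 0} := by
      apply convexHull_min _ (convex_halfSpace_le (LinearMap.isLinear _) 0)
      intro p hp
      simp only [Finset.coe_inter, Set.mem_inter_iff, Finset.mem_coe, Finset.mem_insert,
        Finset.mem_singleton] at hp
      have hpQ : p ∈ Q := by
        obtain ⟨hp1, hp2⟩ := hp
        rcases hp1 with rfl | rfl | rfl | rfl
        · rcases hp2 with rfl | rfl | rfl | rfl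
          · exact absurd rfl h.hne
          all_goals assumption
        all_goals assumption
      simp [h.hpl p hpQ]
    exact this
  have ea := h.hpl a haQ
  have eq' := h.hpl q hqQ
  have eb := h.hpl b hbQ
  rcases lt_or_gt_of_ne hκ with hk | hk
  · obtain ⟨x, hx0, hx1, hx2⟩ := overlap a q b v₂ v₁ ea eq' eb (h.hpar ▸ h.hside) B (-κ) hB hB1
      (by linarith) (fun i => by rw [hi i]; ring)
    have := hflat x (h.inter hσ hτ hx2 hx1)
    simp only [LinearMap.proj_apply] at this
    linarith
  · obtain ⟨x, hx0, hx1, hx2⟩ := overlap a q b v₁ v₂ ea eq' eb h.hside B κ hB hB1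
      hk hi
    have := hflat x (h.inter hσ hτ hx1 hx2)
    simp only [LinearMap.proj_apply] at this
    linarith

lemma Setup.mid_inj (h : Setup Q v₁ v₂ T) {σ τ : Finset Pt3} (hσ : σ ∈ T) (hτ : τ ∈ T) {q : Pt3}
    (h1 : Mid Q (v₂ - v₁) σ q) (h2 : Mid Q (v₂ - v₁) τ q) : σ = τ := by
  obtain ⟨hq, hqQ, ⟨a, ha, haQ, haq⟩, ⟨b, hb, hbQ, hqb⟩⟩ := h1
  obtain ⟨hq', -, ⟨a', ha', haQ', haq'⟩, ⟨b', hb', hbQ', hqb'⟩⟩ := h2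
  obtain ⟨B, κ, hB, hB1, hκ, hi⟩ := h.between haQ hqQ hbQ haq hqb
  obtain ⟨B', κ', hB', hB1', hκ', hi'⟩ := h.between haQ' hqQ hbQ' haq' hqb'
  have qa : a ≠ q := by rintro rfl; linarith
  have qb : b ≠ q := by rintro rfl; linarith
  have qa' : a' ≠ q := by rintro rfl; linarith
  have qb' : b' ≠ q := by rintro rfl; linarith
  -- the two triangles lie on the same side of `q`
  have opp : ∀ (a b a' b' : Pt3) (B κ B' κ' : ℝ), a ∈ Q → b ∈ Q → a' ∈ Q → b' ∈ Q → a ≠ q → b ≠ q →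
      a' ≠ q → b' ≠ q → 0 ≤ B → 0 ≤ 1 - B → 0 ≤ B' → 0 ≤ 1 - B' →
      (∀ i, q i = (1 - B) * a i + B * b i - κ * (v₂ i - v₁ i)) →
      (∀ i, q i = (1 - B') * a' i + B' * b' i - κ' * (v₂ i - v₁ i)) → 0 < κ → κ' < 0 → False := by
    intro a b a' b' B κ B' κ' ha hb ha' hb' qa qb qa' qb' hB hB1 hB' hB1' hi hi' hk hk'
    have hd : 0 < κ - κ' := by linarith
    have hn : 0 ≤ -κ' := by linarith
    refine h.hcp q hqQ (comb_mem _ a b a' b' q (by simp [ha, qa]) (by simp [hb, qb]) (by simp [ha', qa'])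
      (by simp [hb', qb'])
      (-κ' / (κ - κ') * (1 - B)) (-κ' / (κ - κ') * B) (κ / (κ - κ') * (1 - B')) (κ / (κ - κ') * B')
      (by positivity) (by positivity) (by positivity) (by positivity) ?_ (fun i => ?_))
    · field_simp; ring
    · have g1 := hi i
      have g2 := hi' i
      field_simp
      linear_combination -κ' * g1 + κ * g2
  have hprod : 0 < κ * κ' := by
    rcases lt_or_gt_of_ne hκ with hk | hk <;> rcases lt_or_gt_of_ne hκ' with hk' | hk'
    · exact mul_pos_of_neg_of_neg hk hk'
    · exact absurd (opp a' b' a b B' κ' B κ haQ' hbQ' haQ hbQ qa' qb' qa qb hB' hB1' hB hB1 hi' hi hk' hk) id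
    · exact absurd (opp a b a' b' B κ B' κ' haQ hbQ haQ' hbQ' qa qb qa' qb' hB hB1 hB' hB1' hi hi' hk hk') id
    · exact mul_pos hk hk'
  have hsum : κ + κ' ≠ 0 := by
    intro h0
    have : κ' = -κ := by linarith
    rw [this] at hprod
    nlinarith [sq_nonneg κ]
  have hr : 0 < κ' / (κ + κ') ∧ 0 < κ / (κ + κ') := by
    rcases lt_or_gt_of_ne hκ with hk | hk
    · have hk' : κ' < 0 := by nlinarith
      exact ⟨div_pos_of_neg_of_neg hk' (by linarith), div_pos_of_neg_of_neg hk (by linarith)⟩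
    · have hk' : 0 < κ' := by nlinarith
      exact ⟨by positivity, by positivity⟩
  have hr1 : κ' / (κ + κ') + κ / (κ + κ') = 1 := by field_simp; ring
  set u := κ' / (κ + κ') with hu
  set u' := κ / (κ + κ') with hu'
  have huu : u * κ = u' * κ' := by rw [hu, hu']; field_simp
  set x : Pt3 := q + (u * κ) • (v₂ - v₁) with hx
  have hxi : ∀ i, x i = q i + u * κ * (v₂ i - v₁ i) := by intro i; simp [hx]
  have hxσ : x ∈ convexHull ℝ (σ : Set Pt3) := by
    refine comb_mem _ a b q q x ha hb hq hq (u * (1 - B)) (u * B) (1 - u) 0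
      (mul_nonneg hr.1.le hB1) (mul_nonneg hr.1.le hB) (by linarith) le_rfl (by ring) (fun i => ?_)
    rw [hxi i]
    linear_combination u * hi i
  have hxτ : x ∈ convexHull ℝ (τ : Set Pt3) := by
    refine comb_mem _ a' b' q q x ha' hb' hq' hq' (u' * (1 - B')) (u' * B') (1 - u') 0
      (mul_nonneg hr.2.le hB1') (mul_nonneg hr.2.le hB') (by linarith) le_rfl (by ring) (fun i => ?_)
    rw [hxi i]
    linear_combination u' * hi' i + (v₂ i - v₁ i) * huu
  have he2 := h.he2
  simp only [Pi.sub_apply] at he2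
  have hx2 : x 2 = 0 := by rw [hxi 2, he2, h.hpl q hqQ]; ring
  have hxq : x ≠ q := by
    intro hxq
    apply h.he
    ext i
    have := hxi i
    rw [hxq] at this
    have h0 : u * κ * (v₂ i - v₁ i) = 0 := by linarith
    simpa [hr.1.ne', hκ] using h0
  obtain ⟨⟨a₀, ha₀, haQ₀, haq₀⟩, ⟨b₀, hb₀, hbQ₀, hqb₀⟩⟩ :=
    flat_between (σ ∩ τ) Q (fun p hp => h.pos hσ p (Finset.mem_inter.1 hp).1) h.hpl x
      (h.inter hσ hτ hxσ hxτ) hx2 (v₂ - v₁) q (fun p hp => h.hf p hp q hqQ) (by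
      simp only [cr, hxi, Pi.sub_apply]; ring) hxq
  rw [Finset.mem_inter] at ha₀ hb₀
  rcases h.shape hσ ha₀.1 haQ₀ hq hqQ hb₀.1 hbQ₀ haq₀ hqb₀ with s1 | s1 <;>
    rcases h.shape hτ ha₀.2 haQ₀ hq' hqQ hb₀.2 hbQ₀ haq₀ hqb₀ with s2 | s2
  · rw [s1, s2]
  · exact absurd (h.no_overlap haQ₀ hqQ hbQ₀ haq₀ hqb₀ (s1 ▸ hσ) (s2 ▸ hτ)) id
  · exact absurd (h.no_overlap haQ₀ hqQ hbQ₀ haq₀ hqb₀ (s2 ▸ hτ) (s1 ▸ hσ)) id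
  · rw [s1, s2]

end bounds

section counting

variable {Q : Finset Pt3} {v₁ v₂ : Pt3} {T : Finset (Finset Pt3)}

lemma Setup.exists_both (h : Setup Q v₁ v₂ T) : ∃ σ ∈ T, v₁ ∈ σ ∧ v₂ ∈ σ := by
  set x : Pt3 := (1 / 2 : ℝ) • v₁ + (1 / 2 : ℝ) • v₂ with hx
  have hxi : ∀ i, x i = 1 / 2 * v₁ i + 1 / 2 * v₂ i := by intro i; simp [hx]
  have hin : ∀ V : Set Pt3, v₁ ∈ V → v₂ ∈ V → x ∈ convexHull ℝ V := by
    intro V h1 h2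
    refine comb_mem V v₁ v₂ v₂ v₂ x h1 h2 h2 h2 (1 / 2) (1 / 2) 0 0 (by norm_num) (by norm_num) le_rfl
      le_rfl (by norm_num) (fun i => ?_)
    rw [hxi i]; ring
  have hxV := hin ((insert v₁ (insert v₂ Q) : Finset Pt3) : Set Pt3) (by simp) (by simp)
  rw [← h.hT.1.2.2] at hxV
  simp only [Set.mem_iUnion] at hxV
  obtain ⟨σ, hσ, hxσ⟩ := hxV
  have hx2 := hin (({v₁, v₂} : Finset Pt3) : Set Pt3) (by simp) (by simp)
  have hpar := h.hpar
  have hside := h.hside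
  have hmem := sep_lemma (lf 0 0 (-1)) (-(v₁ 2)) σ {v₁, v₂} (by
      intro p hp
      rw [lf_apply]
      rcases h.sub hσ hp with rfl | rfl | h'
      · linarith
      · linarith
      · rw [h.hpl p h']; linarith) (by
      intro p hp
      rw [lf_apply]
      simp only [Finset.mem_insert, Finset.mem_singleton] at hp
      rcases hp with rfl | rfl
      · linarith
      · linarith) (by
      intro p hp hG
      rw [lf_apply] at hG
      rcases h.sub hσ hp with rfl | rfl | h'
      · simp
      · simp
      · rw [h.hpl p h'] at hG; linarith) ⟨hxσ, hx2⟩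
  have key : ∀ v, x ∉ convexHull ℝ (({v} : Finset Pt3) : Set Pt3) ∨ x = v := by
    intro v
    simp [convexHull_singleton]
    tauto
  refine ⟨σ, hσ, ?_, ?_⟩
  · by_contra hn
    have hs : σ ∩ {v₁, v₂} ⊆ {v₂} := by
      intro p hp
      simp only [Finset.mem_inter, Finset.mem_insert, Finset.mem_singleton] at hp ⊢
      rcases hp with ⟨hp, rfl | rfl⟩
      · exact absurd hp hn
      · rfl
    have hm := convexHull_mono (𝕜 := ℝ) (Finset.coe_subset.2 hs) hmem
    have hxv := (key v₂).resolve_left (fun hh => hh hm)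
    apply h.hne
    ext i
    have := hxi i
    rw [hxv] at this
    linarith
  · by_contra hn
    have hs : σ ∩ {v₁, v₂} ⊆ {v₁} := by
      intro p hp
      simp only [Finset.mem_inter, Finset.mem_insert, Finset.mem_singleton] at hp ⊢
      rcases hp with ⟨hp, rfl | rfl⟩
      · rfl
      · exact absurd hp hn
    have hm := convexHull_mono (𝕜 := ℝ) (Finset.coe_subset.2 hs) hmem
    have hxv := (key v₁).resolve_left (fun hh => hh hm)
    apply h.hne
    ext i
    have := hxi i
    rw [hxv] at this
    linarith

lemma Setup.split (T : Finset (Finset Pt3)) (v₁ v₂ : Pt3) :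
    (T.filter (fun σ => v₁ ∈ σ ∧ v₂ ∈ σ)).card + (T.filter (fun σ => ¬ (v₁ ∈ σ ∧ v₂ ∈ σ))).card
      = T.card := Finset.card_filter_add_card_filter_not _

lemma Setup.lower (h : Setup Q v₁ v₂ T) {a b : Pt3} (ha : a ∈ Q) (hb : b ∈ Q) (hab : a ≠ b)
    (hmin : ∀ q ∈ Q, cr (v₂ - v₁) a ≤ cr (v₂ - v₁) q)
    (hmax : ∀ q ∈ Q, cr (v₂ - v₁) q ≤ cr (v₂ - v₁) b) : Q.card - 1 ≤ T.card := by
  obtain ⟨σ₀, hσ₀, h₀⟩ := h.exists_both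
  have hpos : 0 < (T.filter (fun σ => v₁ ∈ σ ∧ v₂ ∈ σ)).card :=
    Finset.card_pos.2 ⟨σ₀, Finset.mem_filter.2 ⟨hσ₀, h₀⟩⟩
  have hle : ((Q.erase a).erase b).card ≤ (T.filter (fun σ => ¬ (v₁ ∈ σ ∧ v₂ ∈ σ))).card := by
    refine Finset.card_le_card_of_forall_subsingleton (fun q σ => Mid Q (v₂ - v₁) σ q) ?_ ?_
    · intro q hq
      simp only [Finset.mem_erase] at hq
      obtain ⟨hqb, hqa, hqQ⟩ := hq
      obtain ⟨σ, hσ, hmid⟩ := h.exists_mid ha hqQ hb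
        (lt_of_le_of_ne (hmin q hqQ) (fun hh => hqa (h.hf _ ha _ hqQ hh).symm))
        (lt_of_le_of_ne (hmax q hqQ) (fun hh => hqb (h.hf _ hqQ _ hb hh)))
      exact ⟨σ, Finset.mem_filter.2 ⟨hσ, h.mid_not_both hσ hmid⟩, hmid⟩
    · intro σ hσ q hq q' hq'
      exact h.mid_unique (Finset.mem_filter.1 hσ).1 hq.2 hq'.2
  rw [Finset.card_erase_of_mem (Finset.mem_erase.2 ⟨hab.symm, hb⟩), Finset.card_erase_of_mem ha] at hle
  have := Setup.split T v₁ v₂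
  omega

lemma Setup.mid_of_not_both (h : Setup Q v₁ v₂ T) {σ : Finset Pt3} (hσ : σ ∈ T)
    (hnb : ¬ (v₁ ∈ σ ∧ v₂ ∈ σ)) : ∃ q, Mid Q (v₂ - v₁) σ q := by
  have hc : 3 ≤ (σ ∩ Q).card := by
    have h1 : (σ \ Q).card ≤ 1 := by
      rw [Finset.card_le_one]
      intro p hp q hq
      rw [Finset.mem_sdiff] at hp hq
      rcases h.sub hσ hp.1 with rfl | rfl | hp'
      · rcases h.sub hσ hq.1 with rfl | rfl | hq'
        · rfl
        · exact absurd ⟨hp.1, hq.1⟩ hnb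
        · exact absurd hq' hq.2
      · rcases h.sub hσ hq.1 with rfl | rfl | hq'
        · exact absurd ⟨hq.1, hp.1⟩ hnb
        · rfl
        · exact absurd hq' hq.2
      · exact absurd hp' hp.2
    have h2 := Finset.card_inter_add_card_sdiff σ Q
    have h3 := (h.hT.1.1 σ hσ).1.1
    omega
  have hne : (σ ∩ Q).Nonempty := Finset.card_pos.1 (by omega)
  obtain ⟨a, ha, hmin⟩ := Finset.exists_min_image (σ ∩ Q) (cr (v₂ - v₁)) hne
  obtain ⟨b, hb, hmax⟩ := Finset.exists_max_image (σ ∩ Q) (cr (v₂ - v₁)) hne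
  have hc' : 0 < (((σ ∩ Q).erase a).erase b).card := by
    have h1 := Finset.pred_card_le_card_erase (s := σ ∩ Q) (a := a)
    have h2 := Finset.pred_card_le_card_erase (s := (σ ∩ Q).erase a) (a := b)
    omega
  obtain ⟨q, hq⟩ := Finset.card_pos.1 hc'
  simp only [Finset.mem_erase] at hq
  obtain ⟨hqb, hqa, hqI⟩ := hq
  have hl := hmin q hqI
  have hu := hmax q hqI
  rw [Finset.mem_inter] at ha hb hqI
  exact ⟨q, hqI.1, hqI.2, ⟨a, ha.1, ha.2, lt_of_le_of_ne hl (fun hh => hqa (h.hf _ ha.2 _ hqI.2 hh).symm)⟩,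
    ⟨b, hb.1, hb.2, lt_of_le_of_ne hu (fun hh => hqb (h.hf _ hqI.2 _ hb.2 hh))⟩⟩

/-- the shape of a tetrahedron containing the top edge -/
lemma Setup.shape_both (h : Setup Q v₁ v₂ T) {σ : Finset Pt3} (hσ : σ ∈ T)
    (h1 : v₁ ∈ σ) (h2 : v₂ ∈ σ) {a b : Pt3} (ha : a ∈ σ) (haQ : a ∈ Q) (hb : b ∈ σ) (hbQ : b ∈ Q)
    (hab : a ≠ b) : σ = {v₁, v₂, a, b} := by
  have w1 := h.v1Q
  have w2 := h.v2Q
  have hc : ({v₁, v₂, a, b} : Finset Pt3).card = 4 := by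
    have d1 : v₁ ≠ a := by rintro rfl; contradiction
    have d2 : v₁ ≠ b := by rintro rfl; contradiction
    have d3 : v₂ ≠ a := by rintro rfl; contradiction
    have d4 : v₂ ≠ b := by rintro rfl; contradiction
    have d5 := h.hne
    rw [Finset.card_insert_of_notMem, Finset.card_insert_of_notMem, Finset.card_insert_of_notMem,
      Finset.card_singleton] <;> simp [*]
  have hs : ({v₁, v₂, a, b} : Finset Pt3) ⊆ σ := by
    intro y hy
    simp only [Finset.mem_insert, Finset.mem_singleton] at hy
    rcases hy with rfl | rfl | rfl | rfl <;> assumption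
  exact (Finset.eq_of_subset_of_card_le hs (by rw [hc, (h.hT.1.1 σ hσ).1.1])).symm

lemma Setup.both_exists (h : Setup Q v₁ v₂ T) {σ : Finset Pt3} (hσ : σ ∈ T)
    (h1 : v₁ ∈ σ) (h2 : v₂ ∈ σ) :
    ∃ b ∈ σ, b ∈ Q ∧ ∃ a ∈ σ, a ∈ Q ∧ cr (v₂ - v₁) a < cr (v₂ - v₁) b := by
  have hc : 1 < (σ ∩ Q).card := by
    have hs : σ \ Q ⊆ {v₁, v₂} := by
      intro p hp
      rw [Finset.mem_sdiff] at hp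
      simp only [Finset.mem_insert, Finset.mem_singleton]
      rcases h.sub hσ hp.1 with h' | h' | h'
      · exact Or.inl h'
      · exact Or.inr h'
      · exact absurd h' hp.2
    have h1 := (Finset.card_le_card hs).trans Finset.card_le_two
    have h2 := Finset.card_inter_add_card_sdiff σ Q
    have h3 := (h.hT.1.1 σ hσ).1.1
    omega
  obtain ⟨p, hp, q, hq, hpq⟩ := Finset.one_lt_card.1 hc
  rw [Finset.mem_inter] at hp hq
  rcases lt_trichotomy (cr (v₂ - v₁) p) (cr (v₂ - v₁) q) with hl | hl | hl
  · exact ⟨q, hq.1, hq.2, p, hp.1, hp.2, hl⟩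
  · exact absurd (h.hf _ hp.2 _ hq.2 hl) hpq
  · exact ⟨p, hp.1, hp.2, q, hq.1, hq.2, hl⟩

lemma Setup.both_inj (h : Setup Q v₁ v₂ T) {σ τ : Finset Pt3} (hσ : σ ∈ T) (hτ : τ ∈ T)
    (h1 : v₁ ∈ σ) (h2 : v₂ ∈ σ) (h1' : v₁ ∈ τ) (h2' : v₂ ∈ τ) {a a' b : Pt3} (hb : b ∈ σ)
    (hb' : b ∈ τ) (hbQ : b ∈ Q) (ha : a ∈ σ) (haQ : a ∈ Q) (ha' : a' ∈ τ) (haQ' : a' ∈ Q)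
    (hlt : cr (v₂ - v₁) a < cr (v₂ - v₁) b) (hlt' : cr (v₂ - v₁) a' < cr (v₂ - v₁) b) : σ = τ := by
  have hab : a ≠ b := by rintro rfl; exact lt_irrefl _ hlt
  have hab' : a' ≠ b := by rintro rfl; exact lt_irrefl _ hlt'
  have sσ := h.shape_both hσ h1 h2 ha haQ hb hbQ hab
  have sτ := h.shape_both hτ h1' h2' ha' haQ' hb' hbQ hab'
  by_cases haa : a = a'
  · rw [sσ, sτ, haa]
  exfalso
  have w1 := h.v1Q
  have w2 := h.v2Q
  obtain ⟨κ, hκ⟩ := express (v₂ - v₁) a' b a h.he2 h.he (h.hpl a' haQ') (h.hpl b hbQ) (h.hpl a haQ)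
    (by intro h; linarith)
  have hρ : 0 < (cr (v₂ - v₁) a' - cr (v₂ - v₁) b) / (cr (v₂ - v₁) a - cr (v₂ - v₁) b) :=
    div_pos_of_neg_of_neg (by linarith) (by linarith)
  set ρ := (cr (v₂ - v₁) a' - cr (v₂ - v₁) b) / (cr (v₂ - v₁) a - cr (v₂ - v₁) b)
  have hk0 := abs_nonneg κ
  have hk1 := neg_abs_le κ
  have hk2 := le_abs_self κ
  have hD : 0 < 1 + ρ + 2 * |κ| := by linarith
  obtain ⟨ε, hε, hεD⟩ : ∃ ε : ℝ, 0 < ε ∧ ε * (1 + ρ + 2 * |κ|) = 1 :=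
    ⟨1 / (1 + ρ + 2 * |κ|), by positivity, by field_simp⟩
  set x : Pt3 := ε • a' + (ε * ρ) • b + (|κ| * ε) • v₁ + (|κ| * ε) • v₂ with hx
  have hxi : ∀ i, x i = ε * a' i + ε * ρ * b i + |κ| * ε * v₁ i + |κ| * ε * v₂ i := by
    intro i; simp [hx]
  have hxτ : x ∈ convexHull ℝ (τ : Set Pt3) :=
    comb_mem _ a' b v₁ v₂ x ha' hb' h1' h2' ε (ε * ρ) (|κ| * ε) (|κ| * ε) hε.le (by positivity)
      (by positivity) (by positivity) (by linarith) hxi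
  have hxσ : x ∈ convexHull ℝ (σ : Set Pt3) := by
    refine comb_mem _ a b v₁ v₂ x ha hb h1 h2 (ε * ρ) ε ((|κ| + κ) * ε) ((|κ| - κ) * ε) (by positivity)
      hε.le (mul_nonneg (by linarith) hε.le) (mul_nonneg (by linarith) hε.le) (by linarith) (fun i => ?_)
    have := hκ i
    simp only [Pi.sub_apply] at this
    rw [hxi i]
    linear_combination ε * this
  have hxI := h.inter hσ hτ hxσ hxτ
  set f := cr (v₂ - v₁) with hf
  have hside := h.hside
  have hv0 : v₁ 2 ≠ 0 := hside.ne'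
  set H : Pt3 →ₗ[ℝ] ℝ := lf (v₂ 1 - v₁ 1) (-(v₂ 0 - v₁ 0)) ((f v₁ - f b) / v₁ 2) with hH
  have hHv1 : H v₁ = -f b := by
    rw [hH, lf_apply, div_mul_cancel₀ _ hv0]
    simp only [hf, cr, Pi.sub_apply]; ring
  have hHv2 : H v₂ = -f b := by
    rw [hH, lf_apply, ← h.hpar, div_mul_cancel₀ _ hv0]
    simp only [hf, cr, Pi.sub_apply]; ring
  have hHq : ∀ q ∈ Q, H q = -f q := by
    intro q hq
    rw [hH, lf_apply, h.hpl q hq]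
    simp only [hf, cr, Pi.sub_apply]; ring
  have hsub : convexHull ℝ ((σ ∩ τ : Finset Pt3) : Set Pt3) ⊆ {y | H y ≤ -f b} := by
    apply convexHull_min _ (convex_halfSpace_le H.isLinear _)
    intro p hp
    rw [Finset.mem_coe, Finset.mem_inter, sσ, sτ] at hp
    simp only [Finset.mem_insert, Finset.mem_singleton] at hp
    simp only [Set.mem_ofPred_eq]
    rcases hp with ⟨rfl | rfl | rfl | rfl, hp2⟩
    · rw [hHv1]
    · rw [hHv2]
    · rcases hp2 with rfl | rfl | rfl | rfl
      · exact absurd haQ w1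
      · exact absurd haQ w2
      · exact absurd rfl haa
      · exact absurd rfl hab
    · rw [hHq _ hbQ]
  have hle : H x ≤ -f b := hsub hxI
  have hHx : H x = -f b + ε * (f b - f a') := by
    rw [hx]
    simp only [map_add, map_smul, smul_eq_mul, hHv1, hHv2, hHq a' haQ', hHq b hbQ]
    linear_combination -(f b) * hεD
  have : 0 < ε * (f b - f a') := mul_pos hε (by linarith)
  linarith

lemma Setup.upper (h : Setup Q v₁ v₂ T) {a b : Pt3} (ha : a ∈ Q) (hb : b ∈ Q) (hab : a ≠ b)
    (hmin : ∀ q ∈ Q, cr (v₂ - v₁) a ≤ cr (v₂ - v₁) q)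
    (hmax : ∀ q ∈ Q, cr (v₂ - v₁) q ≤ cr (v₂ - v₁) b) : T.card ≤ 2 * Q.card - 3 := by
  have hle1 : (T.filter (fun σ => ¬ (v₁ ∈ σ ∧ v₂ ∈ σ))).card ≤ ((Q.erase a).erase b).card := by
    refine Finset.card_le_card_of_forall_subsingleton (fun σ q => Mid Q (v₂ - v₁) σ q) ?_ ?_
    · intro σ hσ
      rw [Finset.mem_filter] at hσ
      obtain ⟨q, hq⟩ := h.mid_of_not_both hσ.1 hσ.2
      refine ⟨q, ?_, hq⟩
      obtain ⟨-, hqQ, ⟨a₁, -, ha₁, hl⟩, ⟨b₁, -, hb₁, hu⟩⟩ := hq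
      simp only [Finset.mem_erase]
      refine ⟨?_, ?_, hqQ⟩
      · rintro rfl
        linarith [hmax b₁ hb₁]
      · rintro rfl
        linarith [hmin a₁ ha₁]
    · intro q _ σ hσ τ hτ
      exact h.mid_inj (Finset.mem_filter.1 hσ.1).1 (Finset.mem_filter.1 hτ.1).1 hσ.2 hτ.2
  have hle2 : (T.filter (fun σ => v₁ ∈ σ ∧ v₂ ∈ σ)).card ≤ (Q.erase a).card := by
    refine Finset.card_le_card_of_forall_subsingleton
      (fun σ c => c ∈ σ ∧ c ∈ Q ∧ ∃ d ∈ σ, d ∈ Q ∧ cr (v₂ - v₁) d < cr (v₂ - v₁) c) ?_ ?_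
    · intro σ hσ
      rw [Finset.mem_filter] at hσ
      obtain ⟨c, hc, hcQ, d, hd, hdQ, hlt⟩ := h.both_exists hσ.1 hσ.2.1 hσ.2.2
      refine ⟨c, Finset.mem_erase.2 ⟨?_, hcQ⟩, hc, hcQ, d, hd, hdQ, hlt⟩
      rintro rfl
      linarith [hmin d hdQ]
    · rintro c _ σ ⟨hσ, hc, hcQ, d, hd, hdQ, hlt⟩ τ ⟨hτ, hc', -, d', hd', hdQ', hlt'⟩
      rw [Finset.mem_filter] at hσ hτ
      exact h.both_inj hσ.1 hτ.1 hσ.2.1 hσ.2.2 hτ.2.1 hτ.2.2 hc hc' hcQ hd hdQ hd' hdQ' hlt hlt'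
  rw [Finset.card_erase_of_mem (Finset.mem_erase.2 ⟨hab.symm, hb⟩), Finset.card_erase_of_mem ha] at hle1
  rw [Finset.card_erase_of_mem ha] at hle2
  have := Setup.split T v₁ v₂
  have h2 : 2 ≤ Q.card := by
    rw [← Finset.card_pair hab]
    exact Finset.card_le_card (by simp [Finset.insert_subset_iff, ha, hb])
  omega

end counting

/-- The minimal triangulation of `R_m` has exactly `m - 1`
tetrahedra and the maximal triangulation has exactly `2m - 3` tetrahedra. -/
theorem min_max_triangulation_of_Rm (m : ℕ) (hm : 3 ≤ m)
    (Q : Finset Pt3) (hQcard : Q.card = m)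
    -- Q lies in the horizontal plane
    (hplane : ∀ q ∈ Q, q 2 = 0)
    -- convex position: Q is the vertex set of a convex m-gon
    (hconv : ∀ q ∈ Q, q ∉ convexHull ℝ ((Q.erase q : Finset Pt3) : Set Pt3))
    (v₁ v₂ : Pt3) (hne : v₁ ≠ v₂)
    -- the segment v₁v₂ is parallel to the plane of Q, on one side of it
    (hpar : v₁ 2 = v₂ 2) (hside : 0 < v₁ 2)
    -- the endpoints project to the interior of the polygon
    (hproj₁ : Function.update v₁ 2 0 ∈ intrinsicInterior ℝ (convexHull ℝ (Q : Set Pt3)))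
    (hproj₂ : Function.update v₂ 2 0 ∈ intrinsicInterior ℝ (convexHull ℝ (Q : Set Pt3)))
    -- v₁v₂ is not parallel to any edge or diagonal of Q
    (hnotpar : ∀ a ∈ Q, ∀ b ∈ Q, a ≠ b → ∀ t : ℝ, v₂ - v₁ ≠ t • (b - a)) :
    (∃ T, IsTriangulation (Q ∪ {v₁, v₂}) T ∧ T.card = m - 1) ∧
    (∀ T, IsTriangulation (Q ∪ {v₁, v₂}) T → m - 1 ≤ T.card) ∧
    (∃ T, IsTriangulation (Q ∪ {v₁, v₂}) T ∧ T.card = 2 * m - 3) ∧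
    (∀ T, IsTriangulation (Q ∪ {v₁, v₂}) T → T.card ≤ 2 * m - 3) := by
  have hV : Q ∪ {v₁, v₂} = insert v₁ (insert v₂ Q) := by
    ext p; simp only [Finset.mem_union, Finset.mem_insert, Finset.mem_singleton]; tauto
  rw [hV]
  have hf : ∀ p ∈ Q, ∀ q ∈ Q, cr (v₂ - v₁) p = cr (v₂ - v₁) q → p = q := by
    intro p hp q hq heq
    by_contra hpq
    have hpq' : q - p ≠ 0 := sub_ne_zero.2 (Ne.symm hpq)
    obtain ⟨t, ht⟩ := par_of_cr (q - p) (v₂ - v₁) (by simp [hplane p hp, hplane q hq]) hpq'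
      (by simp [hpar]) (by
        simp only [cr, Pi.sub_apply] at heq ⊢
        linarith)
    exact hnotpar p hp q hq hpq t (by ext i; simpa using ht i)
  have hQne : Q.Nonempty := Finset.card_pos.1 (by omega)
  obtain ⟨a, ha, hmin⟩ := Finset.exists_min_image Q (cr (v₂ - v₁)) hQne
  obtain ⟨b, hb, hmax⟩ := Finset.exists_max_image Q (cr (v₂ - v₁)) hQne
  have hab : a ≠ b := by
    rintro rfl
    have : Q.card ≤ 1 := Finset.card_le_one.2 (fun p hp q hq =>
      hf p hp q hq (by linarith [hmin p hp, hmax p hp, hmin q hq, hmax q hq]))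
    omega
  have hablt : cr (v₂ - v₁) a < cr (v₂ - v₁) b :=
    lt_of_le_of_ne (hmin b hb) (fun hh => hab (hf a ha b hb hh))
  have hSab : (Q.erase a).erase b ∪ {a, b} = Q := by
    ext p
    simp only [Finset.mem_union, Finset.mem_erase, Finset.mem_insert, Finset.mem_singleton]
    constructor
    · rintro (⟨_, _, hp⟩ | rfl | rfl) <;> assumption
    · intro hp
      tauto
  have hScard : ((Q.erase a).erase b).card = m - 2 := by
    rw [Finset.card_erase_of_mem (Finset.mem_erase.2 ⟨hab.symm, hb⟩), Finset.card_erase_of_mem ha, hQcard]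
    omega
  refine ⟨?_, ?_, ?_, ?_⟩
  · have key := exists_min ((Q.erase a).erase b) a b v₁ v₂ hne hpar hside hablt (by
      intro q hq
      simp only [Finset.mem_erase] at hq
      exact ⟨lt_of_le_of_ne (hmin q hq.2.2) (fun hh => hq.2.1 (hf a ha q hq.2.2 hh).symm),
        lt_of_le_of_ne (hmax q hq.2.2) (fun hh => hq.1 (hf q hq.2.2 b hb hh))⟩)
    rw [hSab, hScard] at key
    obtain ⟨T, hT, hc⟩ := key hplane hconv hf
    exact ⟨T, hT.tri, by omega⟩
  · intro T hT
    have hs : Setup Q v₁ v₂ T := ⟨hplane, hconv, hne, hpar, hside, hf, hT⟩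
    rw [← hQcard]
    exact hs.lower ha hb hab hmin hmax
  · obtain ⟨T, hT, hc⟩ := exists_max Q v₁ v₂ hne hpar hside hplane hconv hf (by omega)
    exact ⟨T, hT.tri, by omega⟩
  · intro T hT
    have hs : Setup Q v₁ v₂ T := ⟨hplane, hconv, hne, hpar, hside, hf, hT⟩
    rw [← hQcard]
    exact hs.upper ha hb hab hmin hmax
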